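/- arXiv:0906.5402 — 6 statements merged into one kernel-verified Lean document; each statement's English description precedes it below -/
import Mathlib

section
/- Let 0 < p < q < ∞. Suppose f is analytic on the open unit disk 𝔻 with ‖f‖_{H^p} < ∞ (i.e. f ∈ H^p), and suppose f has a boundary function f* which belongs to L^q(𝕋, m). Then f ∈ H^q, and moreover ‖f‖_{H^q}^q ≤ ‖f*‖_{L^q(𝕋)}^q (in particular sup_{0<r<1} ∫_𝕋 |f(rη)|^q dm(η) < ∞). -/
open MeasureTheory Complex Metric Set
open scoped ENNReal

/-- Normalized Lebesgue (arc-length) measure on the unit circle `𝕋 ⊆ ℂ`. -/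
noncomputable def circleMeasure : Measure ℂ :=
  Measure.map (fun θ : ℝ => Complex.exp (θ * Complex.I))
    ((ENNReal.ofReal (2 * Real.pi))⁻¹ • volume.restrict (Set.Ioc 0 (2 * Real.pi)))

/-- `‖f‖_{H^p}^p = sup_{0<r<1} ∫_𝕋 |f(rζ)|^p dm(ζ)`, as a value in `[0,∞]`. -/
noncomputable def hardyNorm (p : ℝ) (f : ℂ → ℂ) : ℝ≥0∞ :=
  ⨆ r ∈ Set.Ioo (0 : ℝ) 1,
    ∫⁻ ζ, ENNReal.ofReal (‖f (↑r * ζ)‖ ^ p) ∂circleMeasure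

/-- `‖f‖_{H^∞} = sup_{z ∈ 𝔻} |f(z)|`, as a value in `[0,∞]`. -/
noncomputable def eSupAbs (f : ℂ → ℂ) : ℝ≥0∞ :=
  ⨆ z ∈ Metric.ball (0 : ℂ) 1, ENNReal.ofReal (‖f z‖)

/-- `g` is the boundary function of `f` : radial limits a.e. on `𝕋`. -/
def IsBoundaryFn (f g : ℂ → ℂ) : Prop :=
  ∀ᵐ ζ ∂circleMeasure,
    Filter.Tendsto (fun r : ℝ => f (↑r * ζ)) (nhdsWithin 1 (Set.Iio 1)) (nhds (g ζ))

/-- `Λ(f) = ess sup_{η ∈ 𝕋} ∫_𝕋 |f*(ζ) - f*(η)|/|ζ - η| dm(ζ)` for a boundary function `f*`. -/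
noncomputable def Lam (g : ℂ → ℂ) : ℝ≥0∞ :=
  essSup (fun η =>
    ∫⁻ ζ, ENNReal.ofReal (‖g ζ - g η‖ / ‖ζ - η‖) ∂circleMeasure)
    circleMeasure

/-- Toeplitz operator: `(T_g h)(z) = ∫_𝕋 conj(g*(ζ)) h*(ζ)/(1 - conj(ζ) z) dm(ζ)`,
given boundary functions `gs = g*`, `hs = h*`. -/
noncomputable def toeplitz (gs hs : ℂ → ℂ) : ℂ → ℂ := fun z =>
  ∫ ζ, (starRingEnd ℂ) (gs ζ) * hs ζ / (1 - (starRingEnd ℂ) ζ * z) ∂circleMeasure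

/-- `f̂(n)`, the `n`-th Taylor coefficient of `f` at `0`. -/
noncomputable def taylorCoeff (f : ℂ → ℂ) (n : ℕ) : ℂ :=
  iteratedDeriv n f 0 / n.factorial

/-- `(f*α)(z) = ∑_{n≥0} f̂(n) α_n z^n`. -/
noncomputable def seqConv (f : ℂ → ℂ) (α : ℕ → ℝ) : ℂ → ℂ := fun z =>
  ∑' n : ℕ, taylorCoeff f n * (α n : ℂ) * z ^ n

/-- Partial sum `S_n(f)(z) = ∑_{k=0}^n f̂(k) z^k`. -/
noncomputable def taylorPartial (f : ℂ → ℂ) (n : ℕ) (z : ℂ) : ℂ :=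
  ∑ k ∈ Finset.range (n + 1), taylorCoeff f k * z ^ k

/-- Cesàro mean `σ_n(f)(z) = (1/(n+1)) ∑_{k=0}^n S_k(f)(z)`. -/
noncomputable def cesaro (f : ℂ → ℂ) (n : ℕ) (z : ℂ) : ℂ :=
  ((n : ℂ) + 1)⁻¹ * ∑ k ∈ Finset.range (n + 1), taylorPartial f k z


namespace SmirnovAux

lemma measurable_e : Measurable (fun θ : ℝ => Complex.exp (θ * Complex.I)) := by fun_prop

instance : IsProbabilityMeasure circleMeasure := by
  unfold circleMeasure
  have : IsProbabilityMeasure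
      ((ENNReal.ofReal (2 * Real.pi))⁻¹ • volume.restrict (Set.Ioc 0 (2 * Real.pi))) := by
    constructor
    simp only [Measure.smul_apply, Measure.restrict_apply MeasurableSet.univ, univ_inter,
      Real.volume_Ioc, sub_zero, smul_eq_mul]
    apply ENNReal.inv_mul_cancel
    · simp [Real.pi_pos]
    · exact ENNReal.ofReal_ne_top
  exact Measure.isProbabilityMeasure_map measurable_e.aemeasurable

lemma ae_sphere : ∀ᵐ ζ ∂circleMeasure, ζ ∈ sphere (0 : ℂ) 1 := by
  unfold circleMeasure
  refine (ae_map_iff measurable_e.aemeasurable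
    (p := fun ζ => ζ ∈ sphere (0 : ℂ) 1) (isClosed_sphere.measurableSet)).2 ?_
  refine Filter.Eventually.of_forall fun θ => ?_
  simp [Complex.norm_exp_ofReal_mul_I]

lemma restrict_sphere : circleMeasure.restrict (sphere (0 : ℂ) 1) = circleMeasure :=
  Measure.restrict_eq_self_of_ae_mem ae_sphere

lemma aesm_of_continuousOn {E : Type*} [NormedAddCommGroup E] {F : ℂ → E}
    (hF : ContinuousOn F (sphere (0 : ℂ) 1)) : AEStronglyMeasurable F circleMeasure := by
  rw [← restrict_sphere]
  exact hF.aestronglyMeasurable_of_isCompact (isCompact_sphere _ _) isClosed_sphere.measurableSet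

lemma integrable_of_continuousOn {E : Type*} [NormedAddCommGroup E] {F : ℂ → E}
    (hF : ContinuousOn F (sphere (0 : ℂ) 1)) : Integrable F circleMeasure := by
  rw [← restrict_sphere]
  exact hF.integrableOn_compact (isCompact_sphere _ _)

lemma circleAverage_eq {E : Type*} [NormedAddCommGroup E] [NormedSpace ℝ E] {F : ℂ → E}
    (hF : ContinuousOn F (sphere (0 : ℂ) 1)) :
    Real.circleAverage F 0 1 = ∫ ζ, F ζ ∂circleMeasure := by
  have h := aesm_of_continuousOn hF
  unfold circleMeasure at h ⊢
  rw [integral_map measurable_e.aemeasurable h, Real.circleAverage_def, integral_smul_measure,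
    intervalIntegral.integral_of_le (by positivity)]
  congr 1
  · simp [ENNReal.toReal_ofReal, Real.pi_pos.le]
  · simp [circleMap]

lemma poisson_cont {w : ℂ} (hw : w ∈ ball (0 : ℂ) 1) :
    ContinuousOn (poissonKernel 0 w) (sphere (0 : ℂ) 1) := by
  have : poissonKernel 0 w = fun z => (‖z - 0‖ ^ 2 - ‖w - 0‖ ^ 2) / ‖(z - 0) - (w - 0)‖ ^ 2 := by
    ext z; rfl
  rw [this]
  refine ContinuousOn.div (by fun_prop) (by fun_prop) fun z hz => ?_
  simp only [mem_sphere_iff_norm, mem_ball_iff_norm, sub_zero] at hz hw ⊢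
  have : z - w ≠ 0 := fun h => by
    rw [sub_eq_zero] at h; rw [h] at hz; linarith
  positivity

lemma poisson_nonneg {w ζ : ℂ} (hw : w ∈ ball (0 : ℂ) 1) (hζ : ζ ∈ sphere (0 : ℂ) 1) :
    0 ≤ poissonKernel 0 w ζ := by
  simp only [mem_sphere_iff_norm, mem_ball_iff_norm, sub_zero] at hζ hw
  simp only [poissonKernel_def, sub_zero, hζ]
  apply div_nonneg _ (by positivity)
  nlinarith [norm_nonneg w]

lemma poisson_le {w ζ : ℂ} (hw : w ∈ ball (0 : ℂ) 1) (hζ : ζ ∈ sphere (0 : ℂ) 1) :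
    poissonKernel 0 w ζ ≤ (1 + ‖w‖) / (1 - ‖w‖) := by
  rw [poissonKernel_eq_re_herglotzRieszKernel]
  simpa [herglotzRieszKernel_def] using re_herglotzRieszKernel_le hζ hw

lemma poisson_symm {r : ℝ} {η ζ : ℂ} (hη : η ∈ sphere (0 : ℂ) 1) (hζ : ζ ∈ sphere (0 : ℂ) 1) :
    poissonKernel 0 (r * η) ζ = poissonKernel 0 (r * ζ) η := by
  simp only [mem_sphere_iff_norm, sub_zero] at hζ hη
  simp only [poissonKernel_def, sub_zero, norm_mul, hζ, hη]
  have : ‖ζ - r * η‖ ^ 2 = ‖η - r * ζ‖ ^ 2 := by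
    rw [← Complex.normSq_eq_norm_sq, ← Complex.normSq_eq_norm_sq, Complex.normSq_sub,
      Complex.normSq_sub]
    simp only [Complex.normSq_eq_norm_sq, norm_mul, hζ, hη]
    simp
    ring
  rw [this]

lemma poisson_formula {E : Type*} [NormedAddCommGroup E] [NormedSpace ℂ E] [CompleteSpace E]
    {G : ℂ → E}
    (hG : DiffContOnCl ℂ G (ball 0 1)) {w : ℂ} (hw : w ∈ ball (0 : ℂ) 1) :
    ∫ ζ, poissonKernel 0 w ζ • G ζ ∂circleMeasure = G w := by
  have h := hG.circleAverage_poissonKernel_smul hw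
  rw [circleAverage_eq] at h
  · exact h
  · refine (poisson_cont hw).smul (hG.continuousOn.mono ?_)
    rw [closure_ball _ one_ne_zero]
    exact sphere_subset_closedBall

lemma poisson_one {w : ℂ} (hw : w ∈ ball (0 : ℂ) 1) :
    ∫⁻ ζ, ENNReal.ofReal (poissonKernel 0 w ζ) ∂circleMeasure = 1 := by
  rw [← ofReal_integral_eq_lintegral_ofReal (integrable_of_continuousOn (poisson_cont hw))]
  · have h := poisson_formula (G := fun _ => (1 : ℂ)) diffContOnCl_const hw
    have h2 : ∫ ζ, ((poissonKernel 0 w ζ : ℝ) : ℂ) ∂circleMeasure = 1 := by simpa using h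
    rw [integral_complex_ofReal] at h2
    have : ∫ ζ, poissonKernel 0 w ζ ∂circleMeasure = 1 := by exact_mod_cast h2
    simp [this]
  · filter_upwards [ae_sphere] with ζ hζ using poisson_nonneg hw hζ

lemma norm_le_poisson {G : ℂ → ℂ} (hG : DiffContOnCl ℂ G (ball 0 1)) {w : ℂ}
    (hw : w ∈ ball (0 : ℂ) 1) :
    ‖G w‖ ≤ ∫ ζ, poissonKernel 0 w ζ * ‖G ζ‖ ∂circleMeasure := by
  rw [← poisson_formula hG hw]
  refine (norm_integral_le_integral_norm _).trans (le_of_eq (integral_congr_ae ?_))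
  filter_upwards [ae_sphere] with ζ hζ
  rw [norm_smul, Real.norm_of_nonneg (poisson_nonneg hw hζ)]

/-- Continuous functions on the circle are approximated by `A + conj B`, `A`, `B` entire. -/
lemma approx_aux (Q : C(AddCircle (2 * Real.pi), ℂ))
    (hQ : Q ∈ Submodule.span ℂ (Set.range (@fourier (2 * Real.pi)))) :
    ∃ A B : ℂ → ℂ, Differentiable ℂ A ∧ Differentiable ℂ B ∧
      ∀ x, Q x = A (x.toCircle : ℂ) + (starRingEnd ℂ) (B (x.toCircle : ℂ)) := by
  induction hQ using Submodule.span_induction with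
  | mem x h =>
    obtain ⟨n, rfl⟩ := h
    obtain ⟨k, rfl | rfl⟩ := n.eq_nat_or_neg
    · refine ⟨fun z => z ^ k, 0, by fun_prop, differentiable_const 0, fun x => ?_⟩
      simp [fourier_apply, AddCircle.toCircle_nsmul]
    · refine ⟨0, fun z => z ^ k, differentiable_const 0, by fun_prop, fun x => ?_⟩
      simp [fourier_apply, AddCircle.toCircle_nsmul, AddCircle.toCircle_neg,
        ← Circle.coe_inv_eq_conj]
  | zero => exact ⟨0, 0, differentiable_const 0, differentiable_const 0, by simp⟩
  | add x y _ _ hx hy =>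
    obtain ⟨A, B, hA, hB, h⟩ := hx
    obtain ⟨A', B', hA', hB', h'⟩ := hy
    refine ⟨A + A', B + B', hA.add hA', hB.add hB', fun x => ?_⟩
    simp [h, h']; ring
  | smul a x _ hx =>
    obtain ⟨A, B, hA, hB, h⟩ := hx
    refine ⟨fun z => a * A z, fun z => (starRingEnd ℂ) a * B z, hA.const_mul _, hB.const_mul _,
      fun x => ?_⟩
    simp [h]; ring

lemma approx {φ : ℂ → ℝ} (hφ : ContinuousOn φ (sphere (0 : ℂ) 1)) {ε : ℝ} (hε : 0 < ε) :
    ∃ H : ℂ → ℂ, Differentiable ℂ H ∧ ∀ ζ ∈ sphere (0 : ℂ) 1, |(H ζ).re - φ ζ| ≤ ε := by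
  have : Fact (0 < 2 * Real.pi) := ⟨by positivity⟩
  have hc : Continuous fun x : AddCircle (2 * Real.pi) => ((φ (x.toCircle : ℂ) : ℝ) : ℂ) := by
    refine Complex.continuous_ofReal.comp (hφ.comp_continuous ?_ ?_)
    · exact continuous_subtype_val.comp AddCircle.continuous_toCircle
    · intro x; exact mem_sphere_zero_iff_norm.2 (Circle.norm_coe _)
  let Φ : C(AddCircle (2 * Real.pi), ℂ) := ⟨_, hc⟩
  have hΦ : Φ ∈ (Submodule.span ℂ (Set.range (@fourier (2 * Real.pi)))).topologicalClosure := by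
    rw [span_fourier_closure_eq_top]; trivial
  obtain ⟨Q, hQ, hQd⟩ := Metric.mem_closure_iff.1 hΦ ε hε
  obtain ⟨A, B, hA, hB, h⟩ := approx_aux Q hQ
  refine ⟨fun z => A z + B z, hA.add hB, fun ζ hζ => ?_⟩
  obtain ⟨x, hx⟩ : ∃ x : AddCircle (2 * Real.pi), (x.toCircle : ℂ) = ζ := by
    have hT : 2 * Real.pi ≠ 0 := by positivity
    let c : Circle := ⟨ζ, by simpa [Submonoid.unitSphere] using hζ⟩
    refine ⟨(AddCircle.homeomorphCircle hT).symm c, ?_⟩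
    rw [← AddCircle.homeomorphCircle_apply hT, Homeomorph.apply_symm_apply]
  have h1 : ‖(Q - Φ) x‖ ≤ ε := by
    refine ((Q - Φ).norm_coe_le_norm x).trans ?_
    rw [← dist_eq_norm, dist_comm]; exact hQd.le
  have h2 : ((Q - Φ) x).re = (A ζ + B ζ).re - φ ζ := by
    simp [Φ, h, hx]
  rw [← h2]
  exact (Complex.abs_re_le_norm _).trans h1

lemma subharm_delta {G : ℂ → ℂ} (hG : DiffContOnCl ℂ G (ball 0 1)) {w : ℂ}
    (hw : w ∈ ball (0 : ℂ) 1) {s δ : ℝ} (hs : 0 < s) (hδ : 0 < δ) :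
    ‖G w‖ ^ s ≤ Real.exp (2 * s * δ) *
      ∫ ζ, poissonKernel 0 w ζ * (‖G ζ‖ + δ) ^ s ∂circleMeasure := by
  have hGc : ContinuousOn G (sphere (0 : ℂ) 1) := by
    refine hG.continuousOn.mono ?_
    rw [closure_ball _ one_ne_zero]
    exact sphere_subset_closedBall
  have hφ : ContinuousOn (fun ζ => Real.log (‖G ζ‖ + δ)) (sphere (0 : ℂ) 1) := by
    refine ContinuousOn.log (by fun_prop) fun ζ _ => ?_
    positivity
  obtain ⟨H, hH, hHφ⟩ := approx hφ hδ
  have hHc : Continuous H := hH.continuous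
  -- maximum principle
  have h1 : ‖G w * Complex.exp (-H w)‖ ≤ Real.exp δ := by
    have hd : DiffContOnCl ℂ (fun z => G z * Complex.exp (-H z)) (ball 0 1) :=
      DiffContOnCl.smul (𝕜 := ℂ) hG (hH.neg.cexp).diffContOnCl
    refine Complex.norm_le_of_forall_mem_frontier_norm_le isBounded_ball hd ?_
      (subset_closure hw)
    intro z hz
    rw [frontier_ball _ one_ne_zero] at hz
    rw [norm_mul, Complex.norm_exp, Complex.neg_re]
    have h2 := (abs_le.1 (hHφ z hz)).1
    have h3 : ‖G z‖ ≤ Real.exp ((H z).re + δ) := by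
      calc ‖G z‖ ≤ ‖G z‖ + δ := by linarith
        _ = Real.exp (Real.log (‖G z‖ + δ)) := (Real.exp_log (by positivity)).symm
        _ ≤ _ := Real.exp_le_exp.2 (by linarith)
    calc ‖G z‖ * Real.exp (-(H z).re) ≤ Real.exp ((H z).re + δ) * Real.exp (-(H z).re) := by
          gcongr
      _ = Real.exp δ := by rw [← Real.exp_add]; ring_nf
  have h2 : ‖G w‖ ≤ Real.exp (δ + (H w).re) := by
    rw [norm_mul, Complex.norm_exp, Complex.neg_re, Real.exp_neg, ← div_eq_mul_inv,
      div_le_iff₀ (Real.exp_pos _)] at h1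
    rwa [Real.exp_add]
  have h3 := norm_le_poisson (G := fun z => Complex.exp (s * H z))
    ((hH.const_mul (s : ℂ)).cexp).diffContOnCl hw
  simp only [Complex.norm_exp, Complex.re_ofReal_mul] at h3
  have hP := poisson_cont hw
  have h4 : ∫ ζ, poissonKernel 0 w ζ * Real.exp (s * (H ζ).re) ∂circleMeasure ≤
      Real.exp (s * δ) * ∫ ζ, poissonKernel 0 w ζ * (‖G ζ‖ + δ) ^ s ∂circleMeasure := by
    rw [← integral_const_mul]
    refine integral_mono_ae (integrable_of_continuousOn ?_)
      ((integrable_of_continuousOn ?_).const_mul _) ?_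
    · refine hP.mul (Continuous.continuousOn ?_)
      fun_prop
    · refine hP.mul (ContinuousOn.rpow_const (by fun_prop) fun _ _ => Or.inr hs.le)
    · filter_upwards [ae_sphere] with ζ hζ
      have h5 := (abs_le.1 (hHφ ζ hζ)).2
      have h6 := poisson_nonneg hw hζ
      have hpos : 0 < ‖G ζ‖ + δ := by positivity
      have h7 : Real.exp (s * (H ζ).re) ≤ Real.exp (s * δ) * (‖G ζ‖ + δ) ^ s := by
        rw [Real.rpow_def_of_pos hpos, ← Real.exp_add]
        apply Real.exp_le_exp.2
        nlinarith
      calc _ ≤ poissonKernel 0 w ζ * (Real.exp (s * δ) * (‖G ζ‖ + δ) ^ s) := by gcongr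
        _ = _ := by ring
  calc ‖G w‖ ^ s ≤ (Real.exp (δ + (H w).re)) ^ s := by gcongr
    _ = Real.exp (s * δ) * Real.exp (s * (H w).re) := by
        rw [← Real.exp_mul, ← Real.exp_add]; ring_nf
    _ ≤ Real.exp (s * δ) * (Real.exp (s * δ) *
          ∫ ζ, poissonKernel 0 w ζ * (‖G ζ‖ + δ) ^ s ∂circleMeasure) := by
        gcongr; exact h3.trans h4
    _ = _ := by rw [← mul_assoc, ← Real.exp_add]; ring_nf

lemma subharm {G : ℂ → ℂ} (hG : DiffContOnCl ℂ G (ball 0 1)) {w : ℂ}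
    (hw : w ∈ ball (0 : ℂ) 1) {s : ℝ} (hs : 0 < s) :
    ‖G w‖ ^ s ≤ ∫ ζ, poissonKernel 0 w ζ * ‖G ζ‖ ^ s ∂circleMeasure := by
  have hGc : ContinuousOn G (sphere (0 : ℂ) 1) := by
    refine hG.continuousOn.mono ?_
    rw [closure_ball _ one_ne_zero]
    exact sphere_subset_closedBall
  have hP := poisson_cont hw
  have hcont : ∀ δ : ℝ, ContinuousOn (fun ζ => poissonKernel 0 w ζ * (‖G ζ‖ + δ) ^ s)
      (sphere (0 : ℂ) 1) := fun δ =>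
    hP.mul (ContinuousOn.rpow_const (by fun_prop) fun _ _ => Or.inr hs.le)
  have ht : Filter.Tendsto
      (fun δ : ℝ => ∫ ζ, poissonKernel 0 w ζ * (‖G ζ‖ + δ) ^ s ∂circleMeasure)
      (nhdsWithin 0 (Ioi 0)) (nhds (∫ ζ, poissonKernel 0 w ζ * (‖G ζ‖ + 0) ^ s ∂circleMeasure)) := by
    refine tendsto_integral_filter_of_dominated_convergence
      (fun ζ => poissonKernel 0 w ζ * (‖G ζ‖ + 1) ^ s) ?_ ?_
      (integrable_of_continuousOn (hcont 1)) ?_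
    · exact Filter.Eventually.of_forall fun δ => aesm_of_continuousOn (hcont δ)
    · filter_upwards [Ioo_mem_nhdsGT (zero_lt_one' ℝ)] with δ hδ
      filter_upwards [ae_sphere] with ζ hζ
      have := poisson_nonneg hw hζ
      have h0 := hδ.1
      rw [Real.norm_of_nonneg (by positivity)]
      have h1 := hδ.2.le
      gcongr
    · refine Filter.Eventually.of_forall fun ζ => ?_
      refine Filter.Tendsto.mono_left ?_ nhdsWithin_le_nhds
      have : Continuous fun δ : ℝ => poissonKernel 0 w ζ * (‖G ζ‖ + δ) ^ s :=
        continuous_const.mul ((continuous_const.add continuous_id).rpow_const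
          fun _ => Or.inr hs.le)
      exact this.tendsto 0
  have he : Filter.Tendsto (fun δ : ℝ => Real.exp (2 * s * δ)) (nhdsWithin 0 (Ioi 0))
      (nhds (Real.exp (2 * s * 0))) := by
    refine Filter.Tendsto.mono_left ?_ nhdsWithin_le_nhds
    exact (by fun_prop : Continuous fun δ : ℝ => Real.exp (2 * s * δ)).tendsto 0
  have hlim := he.mul ht
  simp only [mul_zero, Real.exp_zero, one_mul, add_zero] at hlim
  refine ge_of_tendsto hlim ?_
  filter_upwards [self_mem_nhdsWithin] with δ hδ
  exact subharm_delta hG hw hs hδ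

lemma subharm_lintegral {G : ℂ → ℂ} (hG : DiffContOnCl ℂ G (ball 0 1)) {w : ℂ}
    (hw : w ∈ ball (0 : ℂ) 1) {s : ℝ} (hs : 0 < s) :
    ENNReal.ofReal (‖G w‖ ^ s) ≤
      ∫⁻ ζ, ENNReal.ofReal (poissonKernel 0 w ζ) * ENNReal.ofReal (‖G ζ‖ ^ s) ∂circleMeasure := by
  have hGc : ContinuousOn G (sphere (0 : ℂ) 1) := by
    refine hG.continuousOn.mono ?_
    rw [closure_ball _ one_ne_zero]
    exact sphere_subset_closedBall
  refine (ENNReal.ofReal_le_ofReal (subharm hG hw hs)).trans (le_of_eq ?_)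
  rw [ofReal_integral_eq_lintegral_ofReal]
  · refine lintegral_congr_ae ?_
    filter_upwards [ae_sphere] with ζ hζ
    rw [ENNReal.ofReal_mul (poisson_nonneg hw hζ)]
  · exact integrable_of_continuousOn
      ((poisson_cont hw).mul (ContinuousOn.rpow_const (by fun_prop) fun _ _ => Or.inr hs.le))
  · filter_upwards [ae_sphere] with ζ hζ
    have := poisson_nonneg hw hζ
    simp only [Pi.zero_apply]
    positivity

lemma dilate {f : ℂ → ℂ} (hf : DifferentiableOn ℂ f (ball (0 : ℂ) 1)) {r : ℝ}
    (hr : r ∈ Ioo (0 : ℝ) 1) : DiffContOnCl ℂ (fun z => f (r * z)) (ball 0 1) := by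
  apply DifferentiableOn.diffContOnCl
  rw [closure_ball _ one_ne_zero]
  refine hf.comp (by fun_prop) fun z hz => ?_
  simp only [mem_closedBall_zero_iff, mem_ball_zero_iff, norm_mul, Complex.norm_real,
    Real.norm_of_nonneg hr.1.le] at hz ⊢
  nlinarith [hr.1, hr.2, norm_nonneg z]

lemma poisson_meas : Measurable fun x : ℂ × ℂ => poissonKernel 0 x.1 x.2 := by
  simp only [poissonKernel_def]
  fun_prop

lemma poisson_meas' (w : ℂ) : Measurable (poissonKernel 0 w) := by
  have : poissonKernel 0 w = fun z => (‖z - 0‖ ^ 2 - ‖w - 0‖ ^ 2) / ‖(z - 0) - (w - 0)‖ ^ 2 := by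
    ext z; rfl
  rw [this]
  fun_prop

lemma trunc_le (x M : ℝ≥0∞) (hM : M ≠ 0) (hM' : M ≠ ⊤) : x ≤ min x M + x * x / M := by
  rcases le_total x M with h | h
  · rw [min_eq_left h]; exact le_self_add
  · refine le_trans ?_ le_add_self
    rw [ENNReal.le_div_iff_mul_le (Or.inl hM) (Or.inl hM')]
    gcongr

lemma aemeas_dil {f : ℂ → ℂ} (hf : DifferentiableOn ℂ f (ball (0 : ℂ) 1)) {r : ℝ}
    (hr : r ∈ Ioo (0 : ℝ) 1) (s : ℝ) :
    AEMeasurable (fun ζ => ENNReal.ofReal (‖f (r * ζ)‖ ^ s)) circleMeasure := by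
  have h : AEStronglyMeasurable (fun ζ => f (r * ζ)) circleMeasure := by
    apply aesm_of_continuousOn
    refine (dilate hf hr).continuousOn.mono ?_
    rw [closure_ball _ one_ne_zero]
    exact sphere_subset_closedBall
  exact (h.norm.aemeasurable.pow_const s).ennreal_ofReal

lemma key {p : ℝ} (hp : 0 < p) {f fs : ℂ → ℂ}
    (hf : DifferentiableOn ℂ f (Metric.ball (0 : ℂ) 1))
    (hHp : hardyNorm p f ≠ ⊤)
    (hbd : IsBoundaryFn f fs)
    {w : ℂ} (hw : w ∈ ball (0 : ℂ) 1) :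
    ENNReal.ofReal (‖f w‖ ^ (p / 2)) ≤
      ∫⁻ ζ, ENNReal.ofReal (poissonKernel 0 w ζ) * ENNReal.ofReal (‖fs ζ‖ ^ (p / 2))
        ∂circleMeasure := by
  have hs : 0 < p / 2 := by positivity
  set C : ℝ≥0∞ := ENNReal.ofReal ((1 + ‖w‖) / (1 - ‖w‖)) with hC
  have hPC : ∀ᵐ ζ ∂circleMeasure, ENNReal.ofReal (poissonKernel 0 w ζ) ≤ C := by
    filter_upwards [ae_sphere] with ζ hζ
    exact ENNReal.ofReal_le_ofReal (poisson_le hw hζ)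
  have hPm : Measurable fun ζ => ENNReal.ofReal (poissonKernel 0 w ζ) :=
    (poisson_meas' w).ennreal_ofReal
  let ρ : ℕ → ℝ := fun n => 1 - 1 / ((n : ℝ) + 2)
  have hρ : ∀ n, ρ n ∈ Ioo (0 : ℝ) 1 := by
    intro n
    have h1 : (0 : ℝ) < 1 / ((n : ℝ) + 2) := by positivity
    have h2 : 1 / ((n : ℝ) + 2) < 1 := by
      rw [div_lt_one (by positivity)]
      have : (0 : ℝ) ≤ n := n.cast_nonneg
      linarith
    exact ⟨by simp only [ρ]; linarith, by simp only [ρ]; linarith⟩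
  have hρt : Filter.Tendsto ρ Filter.atTop (nhds 1) := by
    have h1 : Filter.Tendsto (fun n : ℕ => 1 / ((n : ℝ) + 2)) Filter.atTop (nhds 0) := by
      refine Filter.Tendsto.div_atTop tendsto_const_nhds ?_
      exact Filter.tendsto_atTop_add_const_right _ _ tendsto_natCast_atTop_atTop
    simpa [ρ] using h1.const_sub 1
  have hρt' : Filter.Tendsto ρ Filter.atTop (nhdsWithin 1 (Iio 1)) :=
    tendsto_nhdsWithin_iff.2 ⟨hρt, Filter.Eventually.of_forall fun n => (hρ n).2⟩
  have hpow : Continuous fun z : ℂ => ENNReal.ofReal (‖z‖ ^ (p / 2)) :=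
    ENNReal.continuous_ofReal.comp (continuous_norm.rpow_const fun _ => Or.inr hs.le)
  -- the left side converges
  have hleft : Filter.Tendsto (fun n => ENNReal.ofReal (‖f (ρ n * w)‖ ^ (p / 2))) Filter.atTop
      (nhds (ENNReal.ofReal (‖f w‖ ^ (p / 2)))) := by
    refine (hpow.tendsto _).comp ?_
    have hc : ContinuousAt f w :=
      (hf.differentiableAt (isOpen_ball.mem_nhds hw)).continuousAt
    refine hc.tendsto.comp ?_
    have : Filter.Tendsto (fun n => (ρ n : ℂ) * w) Filter.atTop (nhds ((1 : ℝ) * w)) :=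
      ((Complex.continuous_ofReal.tendsto 1).comp hρt).mul_const w
    simpa using this
  -- truncated bound
  have hM : ∀ M : ℝ≥0∞, M ≠ 0 → M ≠ ⊤ → ENNReal.ofReal (‖f w‖ ^ (p / 2)) ≤
      (∫⁻ ζ, ENNReal.ofReal (poissonKernel 0 w ζ) * ENNReal.ofReal (‖fs ζ‖ ^ (p / 2))
        ∂circleMeasure) + C * hardyNorm p f / M := by
    intro M hM0 hMt
    have hright : Filter.Tendsto (fun n => ∫⁻ ζ, ENNReal.ofReal (poissonKernel 0 w ζ) *
          min (ENNReal.ofReal (‖f (ρ n * ζ)‖ ^ (p / 2))) M ∂circleMeasure) Filter.atTop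
        (nhds (∫⁻ ζ, ENNReal.ofReal (poissonKernel 0 w ζ) *
          min (ENNReal.ofReal (‖fs ζ‖ ^ (p / 2))) M ∂circleMeasure)) := by
      refine tendsto_lintegral_of_dominated_convergence' (fun _ => C * M) ?_ ?_ ?_ ?_
      · intro n
        exact hPm.aemeasurable.mul ((aemeas_dil hf (hρ n) _).min aemeasurable_const)
      · intro n
        filter_upwards [hPC] with ζ hζ
        exact mul_le_mul' hζ (min_le_right _ _)
      · simp only [lintegral_const, measure_univ, mul_one]
        exact ENNReal.mul_ne_top ENNReal.ofReal_ne_top hMt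
      · filter_upwards [hbd] with ζ hζ
        refine ENNReal.Tendsto.const_mul ?_ (Or.inr ENNReal.ofReal_ne_top)
        exact ((hpow.tendsto _).comp (hζ.comp hρt')).min tendsto_const_nhds
    refine le_of_tendsto_of_tendsto hleft
      ((hright.add_const (C * hardyNorm p f / M)).trans (le_refl _)) ?_ |>.trans ?_
    · refine Filter.Eventually.of_forall fun n => ?_
      refine (subharm_lintegral (dilate hf (hρ n)) hw hs).trans ?_
      calc _ ≤ ∫⁻ ζ, (ENNReal.ofReal (poissonKernel 0 w ζ) *
              min (ENNReal.ofReal (‖f (ρ n * ζ)‖ ^ (p / 2))) M +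
              C / M * ENNReal.ofReal (‖f (ρ n * ζ)‖ ^ p)) ∂circleMeasure := by
            refine lintegral_mono_ae ?_
            filter_upwards [hPC] with ζ hζ
            have hsq : ENNReal.ofReal (‖f (ρ n * ζ)‖ ^ (p / 2)) *
                ENNReal.ofReal (‖f (ρ n * ζ)‖ ^ (p / 2)) = ENNReal.ofReal (‖f (ρ n * ζ)‖ ^ p) := by
              rw [← ENNReal.ofReal_mul (by positivity), ← Real.rpow_add_of_nonneg
                (norm_nonneg _) hs.le hs.le]
              ring_nf
            have := trunc_le (ENNReal.ofReal (‖f (ρ n * ζ)‖ ^ (p / 2))) M hM0 hMt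
            rw [hsq] at this
            refine (mul_le_mul_right this _).trans ?_
            rw [mul_add]
            refine add_le_add_right ?_ _
            rw [div_eq_mul_inv, div_eq_mul_inv,
              mul_comm (ENNReal.ofReal (‖f (ρ n * ζ)‖ ^ p)) M⁻¹, ← mul_assoc]
            exact mul_le_mul_left (mul_le_mul_left hζ _) _
        _ = (∫⁻ ζ, ENNReal.ofReal (poissonKernel 0 w ζ) *
              min (ENNReal.ofReal (‖f (ρ n * ζ)‖ ^ (p / 2))) M ∂circleMeasure) +
              C / M * ∫⁻ ζ, ENNReal.ofReal (‖f (ρ n * ζ)‖ ^ p) ∂circleMeasure := by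
            rw [← lintegral_const_mul'' _ (aemeas_dil hf (hρ n) _)]
            exact lintegral_add_left' (hPm.aemeasurable.mul
              ((aemeas_dil hf (hρ n) _).min aemeasurable_const)) _
        _ ≤ _ := by
            refine add_le_add_right ?_ _
            rw [div_eq_mul_inv, div_eq_mul_inv, mul_right_comm]
            refine mul_le_mul_left (mul_le_mul_right ?_ _) _
            exact le_iSup₂ (f := fun (r : ℝ) (_ : r ∈ Ioo (0 : ℝ) 1) =>
              ∫⁻ ζ, ENNReal.ofReal (‖f (↑r * ζ)‖ ^ p) ∂circleMeasure) (ρ n) (hρ n)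
    · gcongr
      exact min_le_left _ _
  -- let `M → ∞`
  have hlim : Filter.Tendsto (fun n : ℕ =>
      (∫⁻ ζ, ENNReal.ofReal (poissonKernel 0 w ζ) * ENNReal.ofReal (‖fs ζ‖ ^ (p / 2))
        ∂circleMeasure) + C * hardyNorm p f / ((n + 1 : ℕ) : ℝ≥0∞)) Filter.atTop
      (nhds ((∫⁻ ζ, ENNReal.ofReal (poissonKernel 0 w ζ) * ENNReal.ofReal (‖fs ζ‖ ^ (p / 2))
        ∂circleMeasure) + C * hardyNorm p f * 0)) := by
    refine Filter.Tendsto.const_add _ ?_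
    simp only [div_eq_mul_inv]
    refine ENNReal.Tendsto.const_mul ?_
      (Or.inr (ENNReal.mul_ne_top ENNReal.ofReal_ne_top hHp))
    exact ENNReal.tendsto_inv_nat_nhds_zero.comp (Filter.tendsto_add_atTop_nat 1)
  rw [mul_zero, add_zero] at hlim
  refine ge_of_tendsto hlim (Filter.Eventually.of_forall fun n => ?_)
  exact hM _ (by simp) (ENNReal.natCast_ne_top _)

lemma jensen {w : ℂ} (hw : w ∈ ball (0 : ℂ) 1) {x : ℂ → ℝ≥0∞} (hx : AEMeasurable x circleMeasure)
    {t : ℝ} (ht : 1 < t) :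
    (∫⁻ ζ, ENNReal.ofReal (poissonKernel 0 w ζ) * x ζ ∂circleMeasure) ^ t ≤
      ∫⁻ ζ, ENNReal.ofReal (poissonKernel 0 w ζ) * x ζ ^ t ∂circleMeasure := by
  have hPm : Measurable fun ζ => ENNReal.ofReal (poissonKernel 0 w ζ) :=
    (poisson_meas' w).ennreal_ofReal
  set ν := circleMeasure.withDensity fun ζ => ENNReal.ofReal (poissonKernel 0 w ζ) with hν
  have h1 : ν univ = 1 := by
    rw [hν, withDensity_apply _ MeasurableSet.univ, Measure.restrict_univ, poisson_one hw]
  have hxν : AEMeasurable x ν := hx.mono_ac (withDensity_absolutelyContinuous _ _)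
  have e1 := lintegral_withDensity_eq_lintegral_mul₀ hPm.aemeasurable hx
  have e2 := lintegral_withDensity_eq_lintegral_mul₀ hPm.aemeasurable (hx.pow_const t)
  simp only [Pi.mul_apply] at e1 e2
  rw [← e1, ← e2]
  have h := ENNReal.lintegral_mul_le_Lp_mul_Lq ν (Real.HolderConjugate.conjExponent ht) hxν
    (aemeasurable_const (b := (1 : ℝ≥0∞)))
  simp only [Pi.mul_apply, mul_one, ENNReal.one_rpow, lintegral_const, h1] at h
  calc _ ≤ ((∫⁻ a, x a ^ t ∂ν) ^ (1 / t)) ^ t := by gcongr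
    _ = _ := by
      rw [← ENNReal.rpow_mul, one_div, inv_mul_cancel₀ (by positivity), ENNReal.rpow_one]

end SmirnovAux

/-- **Theorem of Smirnov.** If `0 < p < q`, `f ∈ H^p`, and the boundary function `f*` of `f`
belongs to `L^q(𝕋)`, then `f ∈ H^q` and `‖f‖_{H^q}^q ≤ ‖f*‖_{L^q(𝕋)}^q`. -/
theorem smirnov_theorem (p q : ℝ) (hp : 0 < p) (hpq : p < q)
    (f fs : ℂ → ℂ)
    (hf : DifferentiableOn ℂ f (Metric.ball (0 : ℂ) 1))
    (hHp : hardyNorm p f ≠ ⊤)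
    (hbd : IsBoundaryFn f fs)
    (hmeas : AEStronglyMeasurable fs circleMeasure)
    (hLq : ∫⁻ ζ, ENNReal.ofReal (‖fs ζ‖ ^ q) ∂circleMeasure ≠ ⊤) :
    hardyNorm q f ≤ ∫⁻ ζ, ENNReal.ofReal (‖fs ζ‖ ^ q) ∂circleMeasure := by
  have hq : 0 < q := hp.trans hpq
  have hs : 0 < p / 2 := by positivity
  have hfsm : ∀ s : ℝ, AEMeasurable (fun ζ => ENNReal.ofReal (‖fs ζ‖ ^ s)) circleMeasure :=
    fun s => (hmeas.norm.aemeasurable.pow_const s).ennreal_ofReal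
  have ht : 1 < q / (p / 2) := by rw [one_lt_div hs]; linarith
  have hpw : ∀ z : ℂ, ENNReal.ofReal (‖z‖ ^ (p / 2)) ^ (q / (p / 2)) = ENNReal.ofReal (‖z‖ ^ q) := by
    intro z
    rw [ENNReal.ofReal_rpow_of_nonneg (by positivity) (by positivity),
      ← Real.rpow_mul (norm_nonneg _)]
    congr 2
    field_simp
  have hpt : ∀ w ∈ ball (0 : ℂ) 1, ENNReal.ofReal (‖f w‖ ^ q) ≤
      ∫⁻ ζ, ENNReal.ofReal (poissonKernel 0 w ζ) * ENNReal.ofReal (‖fs ζ‖ ^ q)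
        ∂circleMeasure := by
    intro w hw
    have h1 := ENNReal.rpow_le_rpow (SmirnovAux.key hp hf hHp hbd hw)
      (show 0 ≤ q / (p / 2) by positivity)
    have h2 := h1.trans (SmirnovAux.jensen hw (hfsm (p / 2)) ht)
    simpa only [hpw] using h2
  refine iSup₂_le fun r hr => ?_
  have hball : ∀ η ∈ sphere (0 : ℂ) 1, (r : ℂ) * η ∈ ball (0 : ℂ) 1 := by
    intro η hη
    rw [mem_sphere_zero_iff_norm] at hη
    simp [hη, abs_of_pos hr.1, hr.2]
  calc ∫⁻ η, ENNReal.ofReal (‖f (↑r * η)‖ ^ q) ∂circleMeasure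
      ≤ ∫⁻ η, ∫⁻ ζ, ENNReal.ofReal (poissonKernel 0 (r * η) ζ) * ENNReal.ofReal (‖fs ζ‖ ^ q)
        ∂circleMeasure ∂circleMeasure := by
        refine lintegral_mono_ae ?_
        filter_upwards [SmirnovAux.ae_sphere] with η hη using hpt _ (hball η hη)
    _ = ∫⁻ ζ, ∫⁻ η, ENNReal.ofReal (poissonKernel 0 (r * η) ζ) * ENNReal.ofReal (‖fs ζ‖ ^ q)
        ∂circleMeasure ∂circleMeasure := by
        refine lintegral_lintegral_swap ?_
        refine AEMeasurable.mul (Measurable.aemeasurable ?_) (hfsm q).comp_snd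
        refine Measurable.ennreal_ofReal ?_
        exact SmirnovAux.poisson_meas.comp
          ((measurable_fst.const_mul (r : ℂ)).prodMk measurable_snd)
    _ = ∫⁻ ζ, ENNReal.ofReal (‖fs ζ‖ ^ q) ∂circleMeasure := by
        refine lintegral_congr_ae ?_
        filter_upwards [SmirnovAux.ae_sphere] with ζ hζ
        rw [lintegral_mul_const' _ _ ENNReal.ofReal_ne_top]
        have : ∫⁻ η, ENNReal.ofReal (poissonKernel 0 (r * η) ζ) ∂circleMeasure = 1 := by
          rw [← SmirnovAux.poisson_one (hball ζ hζ)]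
          refine lintegral_congr_ae ?_
          filter_upwards [SmirnovAux.ae_sphere] with η hη
          rw [SmirnovAux.poisson_symm hη hζ]
        rw [this, one_mul]
end

section
/- Let 0 < p < ∞. Suppose f is analytic on the open unit disk 𝔻 with ‖f‖_{H^p} < ∞ (i.e. f ∈ H^p), and suppose f has a boundary function f* which belongs to L^∞(𝕋, m). Then f is bounded on 𝔻 and ‖f‖_{H^∞} ≤ ‖f*‖_{L^∞(𝕋)}. -/
open MeasureTheory Complex Metric Set
open scoped ENNReal

open ValueDistribution Filter Topology in
lemma aux_entire_mono {g : ℂ → ℂ} (hg : Differentiable ℂ g) {s r : ℝ} (hs : 0 < s) (hsr : s ≤ r) :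
    Real.circleAverage (fun z => Real.posLog ‖g z‖) 0 s ≤
      Real.circleAverage (fun z => Real.posLog ‖g z‖) 0 r := by
  have hA : AnalyticOnNhd ℂ g univ := fun z _ => hg.analyticAt z
  have hm : Meromorphic g := fun z => (hg.analyticAt z).meromorphicAt
  have h0 : logCounting g ⊤ = 0 := by
    rw [logCounting_top]
    have : (MeromorphicOn.divisor g univ)⁻ = 0 := by
      rw [negPart_eq_zero]
      exact MeromorphicOn.AnalyticOnNhd.divisor_nonneg hA
    rw [this]; simp
  have := characteristic_monotoneOn hm (show s ∈ Ioi 0 from hs)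
    (show r ∈ Ioi 0 from lt_of_lt_of_le hs hsr) hsr
  simpa [characteristic, h0, proximity_top] using this

lemma aux_cont {f : ℂ → ℂ} (hf : DifferentiableOn ℂ f (Metric.ball (0 : ℂ) 1)) {s : ℝ}
    (hs : 0 ≤ s) (hs1 : s < 1) : Continuous (fun θ : ℝ => f (circleMap 0 s θ)) := by
  apply hf.continuousOn.comp_continuous (by fun_prop)
  intro θ
  simp [abs_of_nonneg hs, hs1]

open Filter Topology in
lemma aux_disc_mono {f : ℂ → ℂ} (hf : DifferentiableOn ℂ f (Metric.ball (0 : ℂ) 1)) {s r : ℝ}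
    (hs : 0 < s) (hsr : s ≤ r) (hr : r < 1) :
    Real.circleAverage (fun z => Real.posLog ‖f z‖) 0 s ≤
      Real.circleAverage (fun z => Real.posLog ‖f z‖) 0 r := by
  set a : ℕ → ℂ := fun n => (n.factorial : ℂ)⁻¹ * iteratedDeriv n f 0 with ha
  have hsum : ∀ z ∈ Metric.ball (0 : ℂ) 1, HasSum (fun n => a n * z ^ n) (f z) := by
    intro z hz
    have h := hasSum_taylorSeries_on_ball hf hz
    have he : (fun n => a n * z ^ n) =
        fun n : ℕ => (n.factorial : ℂ)⁻¹ • (z - 0) ^ n • iteratedDeriv n f 0 := by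
      funext n
      simp only [ha, sub_zero, smul_eq_mul]; ring
    rw [he]
    exact h
  set P : ℕ → ℂ → ℂ := fun N z => ∑ k ∈ Finset.range N, a k * z ^ k with hP
  have hPd : ∀ N, Differentiable ℂ (P N) := by intro N; simp only [hP]; fun_prop
  have key : ∀ t : ℝ, 0 < t → t < 1 → Tendsto
      (fun N => Real.circleAverage (fun z => Real.posLog ‖P N z‖) 0 t) atTop
      (𝓝 (Real.circleAverage (fun z => Real.posLog ‖f z‖) 0 t)) := by
    intro t ht ht1
    have hts : Summable (fun n => ‖a n‖ * t ^ n) := by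
      have := (hsum (t : ℂ) (by simp [abs_of_pos ht, ht1])).summable.norm
      simpa [abs_of_pos ht] using this
    simp only [Real.circleAverage_def]
    apply Tendsto.const_smul
    apply intervalIntegral.tendsto_integral_filter_of_dominated_convergence
      (fun _ => Real.posLog (∑' n, ‖a n‖ * t ^ n))
    · refine Eventually.of_forall fun N => Continuous.aestronglyMeasurable ?_
      have := (hPd N).continuous
      fun_prop
    · refine Eventually.of_forall fun N => Eventually.of_forall fun θ _ => ?_
      rw [Real.norm_of_nonneg Real.posLog_nonneg]
      apply Real.posLog_le_posLog (norm_nonneg _)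
      calc ‖P N (circleMap 0 t θ)‖ ≤ ∑ k ∈ Finset.range N, ‖a k * (circleMap 0 t θ) ^ k‖ :=
            norm_sum_le _ _
        _ = ∑ k ∈ Finset.range N, ‖a k‖ * t ^ k := by simp [abs_of_pos ht]
        _ ≤ _ := hts.sum_le_tsum _ (fun i _ => by positivity)
    · simp
    · refine Eventually.of_forall fun θ _ => ?_
      have := (hsum (circleMap 0 t θ) (by simp [abs_of_pos ht, ht1])).tendsto_sum_nat
      exact (Real.continuous_posLog.tendsto _).comp this.norm
  exact le_of_tendsto_of_tendsto' (key s hs (hsr.trans_lt hr)) (key r (hs.trans_le hsr) hr)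
    (fun N => aux_entire_mono (hPd N) hs hsr)

/-- If the circle averages of `log⁺ |f|` tend to zero along a sequence of radii, then `|f| ≤ 1`. -/
lemma aux_le_one {f : ℂ → ℂ} (hf : DifferentiableOn ℂ f (Metric.ball (0 : ℂ) 1))
    (r : ℕ → ℝ) (hr1 : ∀ n, r n < 1) (hr : Filter.Tendsto r Filter.atTop (nhds 1))
    (h : Filter.Tendsto (fun n => ∫ θ in (0 : ℝ)..2 * Real.pi,
      Real.posLog ‖f (circleMap 0 (r n) θ)‖) Filter.atTop (nhds 0)) :
    ∀ z ∈ Metric.ball (0 : ℂ) 1, ‖f z‖ ≤ 1 := by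
  have main : ∀ z ∈ Metric.ball (0 : ℂ) 1, z ≠ 0 → ‖f z‖ ≤ 1 := by
    intro z hz hz0
    have hz1 : ‖z‖ < 1 := by simpa using hz
    have hzp : 0 < ‖z‖ := norm_pos_iff.mpr hz0
    have hle : Real.circleAverage (fun z => Real.posLog ‖f z‖) 0 ‖z‖ ≤ 0 := by
      have h2 : Filter.Tendsto (fun n => Real.circleAverage (fun z => Real.posLog ‖f z‖) 0 (r n))
          Filter.atTop (nhds 0) := by
        simp only [Real.circleAverage_def]
        simpa using h.const_smul (2 * Real.pi)⁻¹
      apply ge_of_tendsto h2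
      filter_upwards [hr.eventually (lt_mem_nhds hz1)] with n hn
      exact aux_disc_mono hf hzp hn.le (hr1 n)
    have hc : Continuous (fun θ : ℝ => Real.posLog ‖f (circleMap 0 ‖z‖ θ)‖) :=
      Real.continuous_posLog.comp (aux_cont hf hzp.le hz1).norm
    by_contra hcon
    push Not at hcon
    have hpos : 0 < Real.posLog ‖f z‖ := by
      rw [Real.posLog_eq_log (by simpa using hcon.le)]
      exact Real.log_pos hcon
    obtain ⟨θ, hθ, hzθ⟩ : ∃ θ ∈ Ico (0 : ℝ) (2 * Real.pi), circleMap 0 ‖z‖ θ = z := by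
      have h3 : z ∈ circleMap 0 ‖z‖ '' Ioc 0 (2 * Real.pi) := by
        rw [image_circleMap_Ioc]; simp
      obtain ⟨θ, hθ, h4⟩ := h3
      rcases eq_or_lt_of_le hθ.2 with h5 | h5
      · refine ⟨0, ⟨le_rfl, by positivity⟩, ?_⟩
        rw [← h4, h5]
        simp [circleMap]
      · exact ⟨θ, ⟨hθ.1.le, h5⟩, h4⟩
    have := intervalIntegral.integral_pos (a := 0) (b := 2 * Real.pi) (by positivity)
      hc.continuousOn (fun _ _ => Real.posLog_nonneg) ⟨θ, ⟨hθ.1, hθ.2.le⟩, by rwa [hzθ]⟩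
    rw [Real.circleAverage_def, smul_eq_mul] at hle
    have : 0 < (2 * Real.pi)⁻¹ * ∫ θ in (0 : ℝ)..2 * Real.pi,
      Real.posLog ‖f (circleMap 0 ‖z‖ θ)‖ := by positivity
    linarith
  intro z hz
  by_cases hz0 : z = 0
  · subst hz0
    have hc : ContinuousAt f 0 := (hf.differentiableAt (Metric.ball_mem_nhds 0 one_pos)).continuousAt
    have h5 : Filter.Tendsto (fun w => ‖f w‖) (nhdsWithin 0 {0}ᶜ) (nhds ‖f 0‖) :=
      (hc.norm.tendsto).mono_left nhdsWithin_le_nhds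
    apply le_of_tendsto h5
    filter_upwards [self_mem_nhdsWithin, mem_nhdsWithin_of_mem_nhds
      (Metric.ball_mem_nhds (0 : ℂ) one_pos)] with w hw hw'
    exact main w hw' hw
  · exact main z hz hz0

lemma aux_posLog_le {p δ : ℝ} (hp : 0 < p) (hδ : 0 < δ) :
    ∃ K : ℝ, 0 ≤ K ∧ ∀ x : ℝ, 0 ≤ x → Real.posLog x ≤ δ * x ^ p + min (Real.posLog x) K := by
  have h := (isLittleO_log_rpow_atTop hp).bound hδ
  obtain ⟨A, hA⟩ := Filter.eventually_atTop.1 h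
  refine ⟨Real.posLog A, Real.posLog_nonneg, fun x hx => ?_⟩
  have hxp : 0 ≤ δ * x ^ p := by positivity
  by_cases hc : Real.posLog x ≤ Real.posLog A
  · rw [min_eq_left hc]; linarith
  · push Not at hc
    have hxA : A ≤ x := by
      by_contra hcon
      push Not at hcon
      exact absurd (Real.posLog_le_posLog hx hcon.le) (not_le.mpr hc)
    have h1 := hA x hxA
    have h2 : 0 ≤ min (Real.posLog x) (Real.posLog A) := le_min Real.posLog_nonneg Real.posLog_nonneg
    have h3 : Real.posLog x ≤ δ * x ^ p := by
      rw [Real.posLog_apply]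
      apply max_le hxp
      rw [Real.norm_of_nonneg (by positivity : 0 ≤ x ^ p)] at h1
      exact (le_abs_self _).trans h1
    linarith

lemma aux_circleMap (r θ : ℝ) : (r : ℂ) * Complex.exp (θ * Complex.I) = circleMap 0 r θ := by
  simp [circleMap]

/-- Real-variable form of the `H^p` bound. -/
lemma aux_Hp {p : ℝ} (hp : 0 < p) {f : ℂ → ℂ} (hf : DifferentiableOn ℂ f (Metric.ball (0 : ℂ) 1))
    (hHp : hardyNorm p f ≠ ⊤) : ∃ C : ℝ, 0 ≤ C ∧ ∀ r : ℝ, 0 < r → r < 1 →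
      ∫ θ in (0 : ℝ)..2 * Real.pi, ‖f (circleMap 0 r θ)‖ ^ p ≤ C := by
  refine ⟨2 * Real.pi * (hardyNorm p f).toReal, by positivity, fun r hr hr1 => ?_⟩
  have hle : ∫⁻ ζ, ENNReal.ofReal (‖f (↑r * ζ)‖ ^ p) ∂circleMeasure ≤ hardyNorm p f :=
    le_iSup₂ (f := fun (r : ℝ) (_ : r ∈ Set.Ioo (0 : ℝ) 1) =>
      ∫⁻ ζ, ENNReal.ofReal (‖f (↑r * ζ)‖ ^ p) ∂circleMeasure) r ⟨hr, hr1⟩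
  have hφ : Measurable (fun θ : ℝ => Complex.exp (θ * Complex.I)) := by fun_prop
  have hcont : ContinuousOn (fun ζ : ℂ => ENNReal.ofReal (‖f (↑r * ζ)‖ ^ p))
      (Metric.sphere (0 : ℂ) 1) := by
    apply ENNReal.continuous_ofReal.comp_continuousOn
    apply (Real.continuous_rpow_const hp.le).comp_continuousOn
    apply ContinuousOn.norm
    apply hf.continuousOn.comp (by fun_prop)
    intro ζ hζ
    have : ‖ζ‖ = 1 := by simpa using hζ
    simp [this, abs_of_pos hr, hr1]
  have hres : circleMeasure.restrict (Metric.sphere (0 : ℂ) 1) = circleMeasure := by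
    apply Measure.restrict_eq_self_of_ae_mem
    unfold circleMeasure
    refine (ae_map_iff (p := fun x => x ∈ Metric.sphere (0 : ℂ) 1) hφ.aemeasurable
      Metric.isClosed_sphere.measurableSet).2 ?_
    exact Filter.Eventually.of_forall fun θ => by simp [Complex.norm_exp_ofReal_mul_I]
  have hmeas : AEMeasurable (fun ζ : ℂ => ENNReal.ofReal (‖f (↑r * ζ)‖ ^ p)) circleMeasure := by
    rw [← hres]
    exact hcont.aemeasurable Metric.isClosed_sphere.measurableSet
  rw [circleMeasure, lintegral_map' hmeas hφ.aemeasurable, lintegral_smul_measure] at hle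
  simp only [aux_circleMap, smul_eq_mul] at hle
  have hc2 : Continuous (fun θ : ℝ => ‖f (circleMap 0 r θ)‖ ^ p) :=
    (Real.continuous_rpow_const hp.le).comp (aux_cont hf hr.le hr1).norm
  rw [intervalIntegral.integral_of_le (by positivity),
    integral_eq_lintegral_of_nonneg_ae (Filter.Eventually.of_forall fun θ => by positivity)
      hc2.aestronglyMeasurable]
  have h2pi : (0 : ℝ) < 2 * Real.pi := by positivity
  rw [mul_comm (2 * Real.pi)]
  rw [ENNReal.inv_mul_le_iff (by simpa using Real.pi_pos) ENNReal.ofReal_ne_top] at hle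
  have := ENNReal.toReal_mono (ENNReal.mul_ne_top ENNReal.ofReal_ne_top hHp) hle
  rw [ENNReal.toReal_mul, ENNReal.toReal_ofReal h2pi.le] at this
  linarith

open Filter Topology in
lemma aux_tendsto {p : ℝ} (hp : 0 < p) {f : ℂ → ℂ}
    (hf : DifferentiableOn ℂ f (Metric.ball (0 : ℂ) 1)) (C : ℝ) (hC : 0 ≤ C)
    (hHp : ∀ r : ℝ, 0 < r → r < 1 → ∫ θ in (0 : ℝ)..2 * Real.pi, ‖f (circleMap 0 r θ)‖ ^ p ≤ C)
    (r : ℕ → ℝ) (hr0 : ∀ n, 0 < r n) (hr1 : ∀ n, r n < 1)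
    (h : ∀ᵐ θ ∂(volume : Measure ℝ), θ ∈ Ioc 0 (2 * Real.pi) →
      Tendsto (fun n => Real.posLog ‖f (circleMap 0 (r n) θ)‖) atTop (𝓝 0)) :
    Tendsto (fun n => ∫ θ in (0 : ℝ)..2 * Real.pi,
      Real.posLog ‖f (circleMap 0 (r n) θ)‖) atTop (𝓝 0) := by
  have h2pi : (0 : ℝ) < 2 * Real.pi := by positivity
  rw [Metric.tendsto_atTop']
  intro ε hε
  obtain ⟨K, hK, hKx⟩ := aux_posLog_le hp (δ := ε / (2 * (C + 1))) (by positivity)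
  have hcn : ∀ n, Continuous (fun θ : ℝ => ‖f (circleMap 0 (r n) θ)‖) :=
    fun n => (aux_cont hf (hr0 n).le (hr1 n)).norm
  have hc1 : ∀ n, Continuous (fun θ : ℝ => Real.posLog ‖f (circleMap 0 (r n) θ)‖) :=
    fun n => Real.continuous_posLog.comp (hcn n)
  have hc2 : ∀ n, Continuous (fun θ : ℝ => min (Real.posLog ‖f (circleMap 0 (r n) θ)‖) K) :=
    fun n => (hc1 n).min continuous_const
  have hc3 : ∀ n, Continuous (fun θ : ℝ => ‖f (circleMap 0 (r n) θ)‖ ^ p) :=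
    fun n => (Real.continuous_rpow_const hp.le).comp (hcn n)
  have hlim : Tendsto (fun n => ∫ θ in (0 : ℝ)..2 * Real.pi,
      min (Real.posLog ‖f (circleMap 0 (r n) θ)‖) K) atTop
      (𝓝 (∫ θ in (0 : ℝ)..2 * Real.pi, (0 : ℝ))) := by
    apply intervalIntegral.tendsto_integral_filter_of_dominated_convergence (fun _ => K)
    · exact Eventually.of_forall fun n => (hc2 n).aestronglyMeasurable
    · refine Eventually.of_forall fun n => Eventually.of_forall fun θ _ => ?_
      rw [Real.norm_of_nonneg (le_min Real.posLog_nonneg hK)]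
      exact min_le_right _ _
    · simp
    · filter_upwards [h] with θ hθ hmem
      rw [uIoc_of_le h2pi.le] at hmem
      have := (hθ hmem).min (tendsto_const_nhds (x := K))
      rwa [min_eq_left hK] at this
  rw [intervalIntegral.integral_zero] at hlim
  obtain ⟨N, hN⟩ := eventually_atTop.1 (hlim.eventually (gt_mem_nhds (half_pos hε)))
  refine ⟨N, fun n hn => ?_⟩
  have h0 : 0 ≤ ∫ θ in (0 : ℝ)..2 * Real.pi, Real.posLog ‖f (circleMap 0 (r n) θ)‖ :=
    intervalIntegral.integral_nonneg h2pi.le fun _ _ => Real.posLog_nonneg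
  rw [Real.dist_eq, sub_zero, abs_of_nonneg h0]
  have h1 : ∫ θ in (0 : ℝ)..2 * Real.pi, Real.posLog ‖f (circleMap 0 (r n) θ)‖ ≤
      ∫ θ in (0 : ℝ)..2 * Real.pi, (ε / (2 * (C + 1)) * ‖f (circleMap 0 (r n) θ)‖ ^ p +
        min (Real.posLog ‖f (circleMap 0 (r n) θ)‖) K) :=
    intervalIntegral.integral_mono h2pi.le ((hc1 n).intervalIntegrable _ _)
      ((((hc3 n).const_mul _).add (hc2 n)).intervalIntegrable _ _)
      (fun θ => hKx _ (norm_nonneg _))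
  rw [intervalIntegral.integral_add (((hc3 n).const_mul _).intervalIntegrable _ _)
    ((hc2 n).intervalIntegrable _ _), intervalIntegral.integral_const_mul] at h1
  have h2 := hN n hn.le
  have h3 : ε / (2 * (C + 1)) * ∫ θ in (0 : ℝ)..2 * Real.pi, ‖f (circleMap 0 (r n) θ)‖ ^ p ≤
      ε / 2 := by
    calc _ ≤ ε / (2 * (C + 1)) * (C + 1) := by
          gcongr
          linarith [hHp (r n) (hr0 n) (hr1 n)]
      _ = ε / 2 := by field_simp
  linarith

/-- **Theorem of Smirnov, case q = ∞.** If `0 < p`, `f ∈ H^p`, and the boundary function `f*`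
of `f` belongs to `L^∞(𝕋)`, then `f` is bounded on `𝔻` and `‖f‖_{H^∞} ≤ ‖f*‖_{L^∞(𝕋)}`. -/
theorem smirnov_theorem_inf (p : ℝ) (hp : 0 < p)
    (f fs : ℂ → ℂ)
    (hf : DifferentiableOn ℂ f (Metric.ball (0 : ℂ) 1))
    (hHp : hardyNorm p f ≠ ⊤)
    (hbd : IsBoundaryFn f fs)
    (hmeas : AEStronglyMeasurable fs circleMeasure)
    (hLinf : essSup (fun ζ => ENNReal.ofReal (‖fs ζ‖)) circleMeasure ≠ ⊤) :
    eSupAbs f ≤ essSup (fun ζ => ENNReal.ofReal (‖fs ζ‖)) circleMeasure := by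
  obtain ⟨C, hC, hCb⟩ := aux_Hp hp hf hHp
  have hφ : Measurable (fun θ : ℝ => Complex.exp (θ * Complex.I)) := by fun_prop
  set S := essSup (fun ζ => ENNReal.ofReal (‖fs ζ‖)) circleMeasure with hS
  have hS_ae : ∀ᵐ ζ ∂circleMeasure, ENNReal.ofReal ‖fs ζ‖ ≤ S := ENNReal.ae_le_essSup _
  have h2pi : (0 : ℝ) < 2 * Real.pi := by positivity
  have hboth : ∀ᵐ θ ∂(volume : Measure ℝ), θ ∈ Ioc 0 (2 * Real.pi) →
      (∃ w : ℂ, ‖w‖ ≤ S.toReal ∧ Filter.Tendsto (fun r : ℝ => f (circleMap 0 r θ))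
        (nhdsWithin 1 (Set.Iio 1)) (nhds w)) := by
    have h1 := ae_of_ae_map hφ.aemeasurable (hbd.and hS_ae)
    rw [Measure.ae_ennreal_smul_measure_eq (ENNReal.inv_ne_zero.2 ENNReal.ofReal_ne_top), ae_restrict_iff' measurableSet_Ioc] at h1
    filter_upwards [h1] with θ hθ hmem
    obtain ⟨ha, hb⟩ := hθ hmem
    refine ⟨_, ?_, by simpa only [aux_circleMap] using ha⟩
    exact (ENNReal.ofReal_le_iff_le_toReal hLinf).1 hb
  have key : ∀ M : ℝ, S.toReal < M → ∀ z ∈ Metric.ball (0 : ℂ) 1, ‖f z‖ ≤ M := by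
    intro M hM z hz
    have hM0 : 0 < M := ENNReal.toReal_nonneg.trans_lt hM
    set g : ℂ → ℂ := fun z => f z / M with hg
    have hgn : ∀ z, ‖g z‖ = ‖f z‖ / M := fun z => by simp [hg, abs_of_pos hM0]
    have hgd : DifferentiableOn ℂ g (Metric.ball (0 : ℂ) 1) := hf.div_const _
    set r : ℕ → ℝ := fun n => 1 - 1 / ((n : ℝ) + 2) with hr
    have hr0 : ∀ n, 0 < r n := fun n => by
      have : 1 / ((n : ℝ) + 2) < 1 := by
        rw [div_lt_one (by positivity)]; linarith [(Nat.cast_nonneg n : (0 : ℝ) ≤ n)]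
      simp only [hr]; linarith
    have hr1 : ∀ n, r n < 1 := fun n => by
      have : 0 < 1 / ((n : ℝ) + 2) := by positivity
      simp only [hr]; linarith
    have hrt : Filter.Tendsto r Filter.atTop (nhds 1) := by
      have h3 : Filter.Tendsto (fun n : ℕ => 1 / ((n : ℝ) + 2)) Filter.atTop (nhds 0) := by
        apply Filter.Tendsto.const_div_atTop
        exact Filter.tendsto_atTop_add_const_right _ _ tendsto_natCast_atTop_atTop
      simpa [hr] using h3.const_sub 1
    have hrt' : Filter.Tendsto r Filter.atTop (nhdsWithin 1 (Set.Iio 1)) :=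
      tendsto_nhdsWithin_iff.2 ⟨hrt, Filter.Eventually.of_forall hr1⟩
    have hle := aux_le_one hgd r hr1 hrt (aux_tendsto hp hgd (C / M ^ p) (by positivity) ?_
      r hr0 hr1 ?_) z hz
    · rw [hgn, div_le_one hM0] at hle
      exact hle
    · intro ρ hρ hρ1
      simp only [hgn, Real.div_rpow (norm_nonneg _) hM0.le, intervalIntegral.integral_div]
      gcongr
      exact hCb ρ hρ hρ1
    · filter_upwards [hboth] with θ hθ hmem
      obtain ⟨w, hw, hlim⟩ := hθ hmem
      have h4 : Filter.Tendsto (fun n => Real.posLog ‖g (circleMap 0 (r n) θ)‖) Filter.atTop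
          (nhds (Real.posLog (‖w‖ / M))) := by
        simp only [hgn]
        exact (Real.continuous_posLog.tendsto _).comp ((hlim.comp hrt').norm.div_const M)
      rwa [(Real.posLog_eq_zero_iff _).2] at h4
      rw [abs_of_nonneg (by positivity), div_le_one hM0]
      linarith
  refine iSup₂_le fun z hz => ?_
  rw [ENNReal.ofReal_le_iff_le_toReal hLinf]
  exact le_of_forall_gt_imp_ge_of_dense fun M hM => key M hM z hz
end

section
/- Let 0 < p < ∞ and let f ∈ H^p have a boundary function f*. Then for every z ∈ 𝔻, |f(z)|^p ≤ ∫_𝕋 |f*(ζ)|^p P_z(ζ) dm(ζ), where P_z(ζ) = (1 − |z|²)/|ζ − z|² is the Poisson kernel. -/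
open MeasureTheory Complex Metric Set
open scoped ENNReal

lemma cm_ae_sphere : ∀ᵐ ζ ∂circleMeasure, ζ ∈ sphere (0:ℂ) 1 := by
  unfold circleMeasure
  refine (ae_map_iff (p := fun ζ => ζ ∈ sphere (0:ℂ) 1) (by fun_prop)
    isClosed_sphere.measurableSet).2 ?_
  refine Filter.Eventually.of_forall fun θ => ?_
  simp [Complex.norm_exp_ofReal_mul_I]

lemma cm_aesm {E : Type*} [NormedAddCommGroup E] {g : ℂ → E}
    (hg : ContinuousOn g (sphere (0:ℂ) 1)) : AEStronglyMeasurable g circleMeasure := by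
  rw [← Measure.restrict_eq_self_of_ae_mem cm_ae_sphere]
  exact hg.aestronglyMeasurable_of_isCompact (isCompact_sphere _ _) isClosed_sphere.measurableSet

instance : IsProbabilityMeasure circleMeasure := by
  constructor
  unfold circleMeasure
  rw [Measure.map_apply (by fun_prop) MeasurableSet.univ]
  simp
  rw [ENNReal.inv_mul_cancel]
  · simp [Real.pi_pos]
  · finiteness

lemma cm_integral {E : Type*} [NormedAddCommGroup E] [NormedSpace ℝ E] {g : ℂ → E}
    (hg : ContinuousOn g (sphere (0:ℂ) 1)) :
    ∫ ζ, g ζ ∂circleMeasure = Real.circleAverage g 0 1 := by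
  have := cm_aesm hg
  unfold circleMeasure at this ⊢
  rw [integral_map (by fun_prop) this, integral_smul_measure, Real.circleAverage_def,
    intervalIntegral.integral_of_le (by positivity)]
  congr 1
  · rw [ENNReal.toReal_inv, ENNReal.toReal_ofReal (by positivity)]
  · simp [circleMap]

lemma cm_integrable {E : Type*} [NormedAddCommGroup E] {g : ℂ → E}
    (hg : ContinuousOn g (sphere (0:ℂ) 1)) : Integrable g circleMeasure := by
  rw [← Measure.restrict_eq_self_of_ae_mem cm_ae_sphere]
  exact hg.integrableOn_compact (isCompact_sphere _ _)

/-- Poisson kernel. -/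
noncomputable def pk (z ζ : ℂ) : ℝ := (1 - ‖z‖ ^ 2) / ‖ζ - z‖ ^ 2

/-- Harmonic measure. -/
noncomputable def hm (z : ℂ) : Measure ℂ :=
  circleMeasure.withDensity (fun ζ => ENNReal.ofReal (pk z ζ))

lemma pk_measurable (z : ℂ) : Measurable (pk z) := by unfold pk; fun_prop

lemma pk_nonneg {z : ℂ} (hz : ‖z‖ < 1) (ζ : ℂ) : 0 ≤ pk z ζ := by
  unfold pk
  have : 0 ≤ 1 - ‖z‖^2 := by nlinarith [norm_nonneg z]
  positivity

lemma pk_cont {z : ℂ} (hz : ‖z‖ < 1) : ContinuousOn (pk z) (sphere (0:ℂ) 1) := by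
  unfold pk
  apply ContinuousOn.div (by fun_prop) (by fun_prop)
  intro x hx
  have : x - z ≠ 0 := by
    intro h
    rw [sub_eq_zero] at h
    simp [h] at hx
    linarith
  positivity

lemma hm_integral {E : Type*} [NormedAddCommGroup E] [NormedSpace ℝ E] {z : ℂ} (hz : ‖z‖ < 1)
    (g : ℂ → E) :
    ∫ ζ, g ζ ∂(hm z) = ∫ ζ, pk z ζ • g ζ ∂circleMeasure := by
  unfold hm
  rw [integral_withDensity_eq_integral_toReal_smul (by have := pk_measurable z; fun_prop) (by simp)]
  simp [ENNReal.toReal_ofReal (pk_nonneg hz _)]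

lemma hm_holo {z : ℂ} (hz : ‖z‖ < 1) {g : ℂ → ℂ} (hg : DiffContOnCl ℂ g (ball 0 1)) :
    ∫ ζ, g ζ ∂(hm z) = g z := by
  rw [hm_integral hz]
  have hc : ContinuousOn g (sphere (0:ℂ) 1) := by
    refine hg.2.mono ?_
    rw [closure_ball _ one_ne_zero]; exact sphere_subset_closedBall
  rw [cm_integral (g := fun ζ => pk z ζ • g ζ) ((pk_cont hz).smul hc),
    ← hg.circleAverage_poissonKernel_smul (w := z) (by simpa using hz)]
  apply Real.circleAverage_congr_sphere
  intro x hx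
  simp at hx
  simp [pk, poissonKernel, hx]

lemma hm_prob {z : ℂ} (hz : ‖z‖ < 1) : IsProbabilityMeasure (hm z) := by
  constructor
  unfold hm
  rw [withDensity_apply _ MeasurableSet.univ, Measure.restrict_univ,
    ← ofReal_integral_eq_lintegral_ofReal (cm_integrable (pk_cont hz)) (.of_forall (pk_nonneg hz))]
  have h := hm_holo hz (g := fun _ => 1) diffContOnCl_const
  rw [hm_integral hz] at h
  have h2 : ((∫ ζ, pk z ζ ∂circleMeasure : ℝ) : ℂ) = 1 := by
    rw [← h, ← integral_complex_ofReal]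
    simp
  rw [Complex.ofReal_eq_one.1 h2]; simp

lemma hm_ac (z : ℂ) : hm z ≪ circleMeasure := withDensity_absolutelyContinuous _ _

lemma hm_integrable {E : Type*} [NormedAddCommGroup E] {z : ℂ} (hz : ‖z‖ < 1) {g : ℂ → E}
    (hg : ContinuousOn g (sphere (0:ℂ) 1)) : Integrable g (hm z) := by
  have := hm_prob hz
  rw [← Measure.restrict_eq_self_of_ae_mem ((hm_ac z).ae_le cm_ae_sphere)]
  exact hg.integrableOn_compact (isCompact_sphere _ _)

lemma hm_bound {z : ℂ} (hz : ‖z‖ < 1) : ∃ C : ℝ, 0 ≤ C ∧ ∀ g : ℂ → ℝ≥0∞,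
    ∫⁻ ζ, g ζ ∂(hm z) ≤ ENNReal.ofReal C * ∫⁻ ζ, g ζ ∂circleMeasure := by
  obtain ⟨C, hC⟩ := (isCompact_sphere (0:ℂ) 1).exists_bound_of_continuousOn (pk_cont hz)
  refine ⟨C, (norm_nonneg _).trans (hC 1 (by simp)), fun g => ?_⟩
  unfold hm
  rw [lintegral_withDensity_eq_lintegral_mul_non_measurable _
    (by have := pk_measurable z; fun_prop) (.of_forall (by simp)),
    ← lintegral_const_mul' _ _ (by simp)]
  apply lintegral_mono_ae
  filter_upwards [cm_ae_sphere] with ζ hζ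
  simp only [Pi.mul_apply]
  gcongr
  exact (le_abs_self _).trans (hC ζ hζ)

/-- trigonometric polynomials have the same real part as polynomials -/
lemma trig_re (s : C(AddCircle (2 * Real.pi), ℂ))
    (hs : s ∈ Submodule.span ℂ (range <| @fourier (2 * Real.pi))) :
    ∀ c : ℂ, ∃ q : ℂ → ℂ, Differentiable ℂ q ∧
      ∀ θ : ℝ, (c * s (θ : AddCircle (2 * Real.pi))).re = (q (Complex.exp (θ * I))).re := by
  have key : ∀ (n : ℤ) (θ : ℝ), fourier n (θ : AddCircle (2 * Real.pi)) = Complex.exp (θ * I) ^ n := by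
    intro n θ
    rw [fourier_coe_apply, ← Complex.exp_int_mul]
    congr 1
    have := Real.pi_pos.ne'
    push_cast
    field_simp
  induction hs using Submodule.span_induction with
  | mem x hx =>
    obtain ⟨n, rfl⟩ := hx
    intro c
    obtain ⟨m, rfl | rfl⟩ := n.eq_nat_or_neg
    · refine ⟨fun w => c * w ^ m, by fun_prop, fun θ => ?_⟩
      rw [key]; simp
    · refine ⟨fun w => (starRingEnd ℂ) c * w ^ m, by fun_prop, fun θ => ?_⟩
      rw [fourier_neg, key, ← Complex.conj_re]
      simp
  | zero => exact fun c => ⟨0, by fun_prop, by simp⟩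
  | add x y _ _ hx hy =>
    intro c
    obtain ⟨q, hq, h⟩ := hx c
    obtain ⟨q', hq', h'⟩ := hy c
    refine ⟨q + q', by fun_prop, fun θ => ?_⟩
    simp only [ContinuousMap.add_apply, mul_add, Complex.add_re, Pi.add_apply, h, h']
  | smul a x _ hx =>
    intro c
    obtain ⟨q, hq, h⟩ := hx (c * a)
    refine ⟨q, hq, fun θ => ?_⟩
    rw [← h]; simp [mul_assoc]

lemma approx {h : ℂ → ℝ} (hh : ContinuousOn h (sphere (0:ℂ) 1)) {η : ℝ} (hη : 0 < η) :
    ∃ q : ℂ → ℂ, Differentiable ℂ q ∧ ∀ ζ ∈ sphere (0:ℂ) 1, |h ζ - (q ζ).re| ≤ η := by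
  have : Fact (0 < 2 * Real.pi) := ⟨Real.two_pi_pos⟩
  have hc : Continuous (fun x : AddCircle (2 * Real.pi) => (h (AddCircle.toCircle x : ℂ) : ℂ)) := by
    refine Complex.continuous_ofReal.comp (hh.comp_continuous ?_ ?_)
    · exact continuous_subtype_val.comp AddCircle.continuous_toCircle
    · intro x; simpa using Circle.norm_coe x.toCircle
  let H : C(AddCircle (2 * Real.pi), ℂ) := ⟨_, hc⟩
  have hH : H ∈ closure ((Submodule.span ℂ (range <| @fourier (2 * Real.pi)) : Set C(AddCircle (2 * Real.pi), ℂ))) := by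
    rw [← Submodule.topologicalClosure_coe, span_fourier_closure_eq_top]; trivial
  obtain ⟨s, hs, hd⟩ := Metric.mem_closure_iff.1 hH η hη
  obtain ⟨q, hq, hq'⟩ := trig_re s hs 1
  refine ⟨q, hq, fun ζ hζ => ?_⟩
  have hζ' : Complex.exp (ζ.arg * I) = ζ := by
    have := Complex.norm_mul_exp_arg_mul_I ζ
    rw [mem_sphere_zero_iff_norm.1 hζ] at this
    simpa using this
  have h1 := (ContinuousMap.dist_apply_le_dist (f := H) (g := s) (ζ.arg : AddCircle (2 * Real.pi))).trans hd.le
  have h2 : H (ζ.arg : AddCircle (2 * Real.pi)) = h ζ := by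
    simp only [H, ContinuousMap.coe_mk]
    rw [AddCircle.toCircle_apply_mk]
    rw [div_self Real.two_pi_pos.ne']
    simp [hζ']
  have h3 := hq' ζ.arg
  rw [hζ', one_mul] at h3
  rw [← h3]
  rw [dist_eq_norm, h2] at h1
  simpa using (Complex.abs_re_le_norm _).trans h1

lemma subharm {z : ℂ} (hz : ‖z‖ < 1) {F : ℂ → ℂ} (hF : DiffContOnCl ℂ F (ball 0 1))
    {h : ℂ → ℝ} (hh : ContinuousOn h (sphere (0:ℂ) 1))
    (hFh : ∀ ζ ∈ sphere (0:ℂ) 1, ‖F ζ‖ ≤ Real.exp (h ζ)) :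
    ‖F z‖ ≤ Real.exp (∫ ζ, h ζ ∂(hm z)) := by
  have := hm_prob hz
  have main : ∀ η > 0, ‖F z‖ ≤ Real.exp (∫ ζ, h ζ ∂(hm z) + 2 * η) := by
    intro η hη
    obtain ⟨q, hq, hq'⟩ := approx hh hη
    have hG : DiffContOnCl ℂ (fun w => Complex.exp (- q w) * F w) (ball 0 1) := by
      have : Differentiable ℂ (fun w => Complex.exp (- q w)) := by fun_prop
      exact this.diffContOnCl.smul hF
    have h1 := Complex.norm_le_of_forall_mem_frontier_norm_le isBounded_ball hG (C := Real.exp η)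
      (by
        intro ζ hζ
        rw [frontier_ball _ one_ne_zero] at hζ
        rw [norm_mul, Complex.norm_exp]
        calc _ ≤ Real.exp ((-q ζ).re) * Real.exp (h ζ) := by gcongr; exact hFh ζ hζ
          _ ≤ _ := by
            rw [← Real.exp_add]
            gcongr
            have := (abs_le.1 (hq' ζ hζ)).2
            simp; linarith) (z := z) (subset_closure (by simpa using hz))
    have h2 : (q z).re ≤ ∫ ζ, h ζ ∂(hm z) + η := by
      rw [← hm_holo hz hq.diffContOnCl]
      have hqi : Integrable q (hm z) := hm_integrable hz hq.continuous.continuousOn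
      have hhi : Integrable h (hm z) := hm_integrable hz hh
      have e1 : (∫ ζ, q ζ ∂(hm z)).re = ∫ ζ, (q ζ).re ∂(hm z) := (integral_re hqi).symm
      have e2 : ∫ ζ, h ζ ∂(hm z) + η = ∫ ζ, (h ζ + η) ∂(hm z) := by
        rw [integral_add hhi (integrable_const _)]; simp
      rw [e1, e2]
      apply integral_mono_ae hqi.re (hhi.add (integrable_const _))
      filter_upwards [(hm_ac z).ae_le cm_ae_sphere] with ζ hζ
      have := (abs_le.1 (hq' ζ hζ)).1
      show (q ζ).re ≤ h ζ + η
      linarith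
    rw [norm_mul, Complex.norm_exp] at h1
    calc ‖F z‖ = Real.exp (q z).re * (Real.exp ((-q z).re) * ‖F z‖) := by
          rw [← mul_assoc, ← Real.exp_add]; simp
      _ ≤ Real.exp (q z).re * Real.exp η := by gcongr
      _ ≤ _ := by
        rw [← Real.exp_add]; apply Real.exp_le_exp.2; linarith
  have ht : Filter.Tendsto (fun η : ℝ => Real.exp (∫ ζ, h ζ ∂(hm z) + 2 * η)) (nhdsWithin 0 (Ioi 0))
      (nhds (Real.exp (∫ ζ, h ζ ∂(hm z) + 2 * 0))) :=
    (Continuous.tendsto (by fun_prop) 0).mono_left nhdsWithin_le_nhds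
  rw [mul_zero, add_zero] at ht
  exact ge_of_tendsto ht (by filter_upwards [self_mem_nhdsWithin] with η hη using main η hη)

/-- truncated logarithm -/
noncomputable def tl (ε K x : ℝ) : ℝ := min (Real.log (max x ε)) K

lemma tl_cont {ε : ℝ} (hε : 0 < ε) (K : ℝ) : Continuous (tl ε K) := by
  unfold tl
  refine Continuous.min (Continuous.log (by fun_prop) fun x => ?_) continuous_const
  exact (lt_of_lt_of_le hε (le_max_right _ _)).ne'

lemma tl_bound {ε K : ℝ} (hε : 0 < ε) (hK : Real.log ε ≤ K) (x : ℝ) :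
    |tl ε K x| ≤ max |Real.log ε| |K| := by
  apply abs_le_max_abs_abs
  · exact le_min (Real.log_le_log hε (le_max_right _ _)) hK
  · exact min_le_right _ _

lemma exists_K {p δ ε : ℝ} (hp : 0 < p) (hδ : 0 < δ) (hε : 0 < ε) : ∃ K : ℝ, Real.log ε ≤ K ∧
    ∀ x : ℝ, 0 ≤ x → Real.log (max x ε) ≤ δ * x ^ p + tl ε K x := by
  refine ⟨max (Real.log ε) (- Real.log (δ * p) / p), le_max_left _ _, fun x hx => ?_⟩
  have hxp : 0 ≤ δ * x ^ p := by positivity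
  unfold tl
  rcases min_choice (Real.log (max x ε)) (max (Real.log ε) (- Real.log (δ * p) / p)) with h | h
  · rw [h]; linarith
  · rw [h]
    rcases le_total x ε with h1 | h1
    · rw [max_eq_right h1]
      have := le_max_left (Real.log ε) (- Real.log (δ * p) / p)
      linarith
    · rw [max_eq_left h1]
      have hx0 : 0 < x := hε.trans_le h1
      have h2 := Real.log_le_sub_one_of_pos (x := δ * p * x ^ p) (by positivity)
      rw [Real.log_mul (by positivity) (by positivity), Real.log_rpow hx0] at h2
      have h3 : Real.log x ≤ δ * x ^ p + - Real.log (δ * p) / p := by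
        rw [← sub_le_iff_le_add', le_div_iff₀ hp]
        nlinarith
      have := le_max_right (Real.log ε) (- Real.log (δ * p) / p)
      linarith

lemma exp_tl_le {p ε K x : ℝ} (hp : 0 < p) (hε : 0 < ε) (hx : 0 ≤ x) :
    Real.exp (p * tl ε K x) ≤ x ^ p + ε ^ p := by
  have hm0 : 0 < max x ε := lt_of_lt_of_le hε (le_max_right _ _)
  calc Real.exp (p * tl ε K x) ≤ Real.exp (p * Real.log (max x ε)) := by
        gcongr; exact min_le_left _ _
    _ = (max x ε) ^ p := by rw [Real.rpow_def_of_pos hm0, mul_comm]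
    _ ≤ x ^ p + ε ^ p := by
        have := Real.rpow_nonneg hx p
        have := Real.rpow_nonneg hε.le p
        rcases max_choice x ε with h | h <;> rw [h] <;> linarith

lemma dilate_diff {f : ℂ → ℂ} (hf : DifferentiableOn ℂ f (Metric.ball (0 : ℂ) 1))
    {r : ℝ} (hr : r ∈ Ioo (0:ℝ) 1) : DiffContOnCl ℂ (fun w => f (r * w)) (ball 0 1) := by
  apply DifferentiableOn.diffContOnCl
  rw [closure_ball _ one_ne_zero]
  refine hf.comp (by fun_prop) ?_
  intro w hw
  simp only [mem_closedBall, dist_zero_right, mem_ball, norm_mul, norm_real, Real.norm_eq_abs,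
    abs_of_pos hr.1] at hw ⊢
  nlinarith [hr.1, hr.2, norm_nonneg w]

lemma dilate_cont {f : ℂ → ℂ} (hf : DifferentiableOn ℂ f (Metric.ball (0 : ℂ) 1))
    {r : ℝ} (hr : r ∈ Ioo (0:ℝ) 1) : ContinuousOn (fun w => f (r * w)) (sphere (0:ℂ) 1) := by
  refine (dilate_diff hf hr).2.mono ?_
  rw [closure_ball _ one_ne_zero]; exact sphere_subset_closedBall

/-- The estimate on a smaller circle. -/
lemma step_r {p : ℝ} (hp : 0 < p) {f : ℂ → ℂ} (hf : DifferentiableOn ℂ f (Metric.ball (0 : ℂ) 1))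
    {z : ℂ} (hz : ‖z‖ < 1) {B : ℝ} (hB : 0 ≤ B)
    {r : ℝ} (hr : r ∈ Ioo (0:ℝ) 1)
    (hBr : ∫⁻ ζ, ENNReal.ofReal (‖f (↑r * ζ)‖ ^ p) ∂(hm z) ≤ ENNReal.ofReal B)
    {δ ε K : ℝ} (hδ : 0 < δ) (hε : 0 < ε)
    (hK : ∀ x : ℝ, 0 ≤ x → Real.log (max x ε) ≤ δ * x ^ p + tl ε K x) :
    ‖f (r * z)‖ ≤ Real.exp (δ * B + ∫ ζ, tl ε K ‖f (r * ζ)‖ ∂(hm z)) := by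
  have hc := dilate_cont hf hr
  have hpos : ∀ x : ℝ, 0 < max x ε := fun x => lt_of_lt_of_le hε (le_max_right _ _)
  have c1 : ContinuousOn (fun ζ : ℂ => Real.log (max ‖f (r * ζ)‖ ε)) (sphere (0:ℂ) 1) :=
    ContinuousOn.log (ContinuousOn.sup hc.norm continuousOn_const) fun x _ => (hpos _).ne'
  have c2 : ContinuousOn (fun ζ : ℂ => ‖f (r * ζ)‖ ^ p) (sphere (0:ℂ) 1) :=
    hc.norm.rpow_const fun _ _ => Or.inr hp.le
  have c3 : ContinuousOn (fun ζ : ℂ => tl ε K ‖f (r * ζ)‖) (sphere (0:ℂ) 1) :=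
    (tl_cont hε K).comp_continuousOn hc.norm
  refine (subharm hz (dilate_diff hf hr) c1 ?_).trans ?_
  · intro ζ _
    rw [Real.exp_log (hpos _)]; exact le_max_left _ _
  · apply Real.exp_le_exp.2
    have i2 := hm_integrable hz c2
    have i3 := hm_integrable hz c3
    have hI : ∫ ζ, ‖f (r * ζ)‖ ^ p ∂(hm z) ≤ B := by
      rw [integral_eq_lintegral_of_nonneg_ae (.of_forall fun _ => by positivity) i2.1]
      exact ENNReal.toReal_le_of_le_ofReal hB hBr
    calc _ ≤ ∫ ζ, (δ * ‖f (r * ζ)‖ ^ p + tl ε K ‖f (r * ζ)‖) ∂(hm z) :=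
          integral_mono (hm_integrable hz c1) ((i2.const_mul δ).add i3)
            fun ζ => hK _ (norm_nonneg _)
      _ = δ * ∫ ζ, ‖f (r * ζ)‖ ^ p ∂(hm z) + ∫ ζ, tl ε K ‖f (r * ζ)‖ ∂(hm z) := by
          rw [integral_add (i2.const_mul δ) i3, integral_const_mul]
      _ ≤ _ := by gcongr

lemma step_lim {p : ℝ} (hp : 0 < p) {f fs : ℂ → ℂ}
    (hf : DifferentiableOn ℂ f (Metric.ball (0 : ℂ) 1)) (hbd : IsBoundaryFn f fs)
    {z : ℂ} (hz : ‖z‖ < 1) {B : ℝ} (hB : 0 ≤ B)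
    (hBr : ∀ r ∈ Ioo (0:ℝ) 1,
      ∫⁻ ζ, ENNReal.ofReal (‖f (↑r * ζ)‖ ^ p) ∂(hm z) ≤ ENNReal.ofReal B)
    {δ : ℝ} (hδ : 0 < δ) (hI : ∫⁻ ζ, ENNReal.ofReal (‖fs ζ‖ ^ p) ∂(hm z) ≠ ⊤) :
    ‖f z‖ ^ p ≤ Real.exp (p * (δ * B)) *
      ((∫⁻ ζ, ENNReal.ofReal (‖fs ζ‖ ^ p) ∂(hm z)).toReal + δ ^ p) := by
  have := hm_prob hz
  obtain ⟨K, hK0, hK⟩ := exists_K hp hδ hδ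
  let r : ℕ → ℝ := fun n => 1 - 1 / ((n : ℝ) + 2)
  have hr : ∀ n, r n ∈ Ioo (0:ℝ) 1 := by
    intro n
    have h1 : (0:ℝ) < 1 / ((n:ℝ) + 2) := by positivity
    have h2 : 1 / ((n:ℝ) + 2) < 1 := by
      rw [div_lt_one (by positivity)]
      have : (0:ℝ) ≤ n := n.cast_nonneg
      linarith
    constructor <;> simp only [r] <;> linarith
  have hrt : Filter.Tendsto r Filter.atTop (nhds 1) := by
    have h1 : Filter.Tendsto (fun n : ℕ => 1 / ((n : ℝ) + 2)) Filter.atTop (nhds 0) := by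
      have := tendsto_one_div_add_atTop_nhds_zero_nat (𝕜 := ℝ)
      have := (Filter.tendsto_add_atTop_iff_nat 1).2 this
      refine this.congr fun n => ?_
      push_cast; ring
    simpa [r] using h1.const_sub 1
  have hrt' : Filter.Tendsto r Filter.atTop (nhdsWithin 1 (Iio 1)) :=
    tendsto_nhdsWithin_iff.2 ⟨hrt, .of_forall fun n => (hr n).2⟩
  have hlim : ∀ᵐ ζ ∂(hm z), Filter.Tendsto (fun n => f (r n * ζ)) Filter.atTop (nhds (fs ζ)) := by
    filter_upwards [(hm_ac z).ae_le hbd] with ζ hζ using hζ.comp hrt'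
  have hmeas : ∀ n, AEStronglyMeasurable (fun ζ => f (r n * ζ)) (hm z) :=
    fun n => (hm_integrable hz (dilate_cont hf (hr n))).1
  have hfsm : AEStronglyMeasurable fs (hm z) := aestronglyMeasurable_of_tendsto_ae _ hmeas hlim
  have htm : AEStronglyMeasurable (fun ζ => tl δ K ‖fs ζ‖) (hm z) :=
    (tl_cont hδ K).comp_aestronglyMeasurable hfsm.norm
  have hti : Integrable (fun ζ => tl δ K ‖fs ζ‖) (hm z) :=
    Integrable.of_bound htm _ (.of_forall fun ζ => tl_bound hδ hK0 _)
  have hint : Filter.Tendsto (fun n => ∫ ζ, tl δ K ‖f (r n * ζ)‖ ∂(hm z)) Filter.atTop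
      (nhds (∫ ζ, tl δ K ‖fs ζ‖ ∂(hm z))) := by
    refine tendsto_integral_of_dominated_convergence (fun _ => max |Real.log δ| |K|)
      (fun n => (tl_cont hδ K).comp_aestronglyMeasurable (hmeas n).norm) (integrable_const _)
      (fun n => .of_forall fun ζ => tl_bound hδ hK0 _) ?_
    filter_upwards [hlim] with ζ hζ
    exact ((tl_cont hδ K).tendsto _).comp hζ.norm
  have hfz : Filter.Tendsto (fun n => ‖f (r n * z)‖) Filter.atTop (nhds ‖f z‖) := by
    have hzb : z ∈ ball (0:ℂ) 1 := by simpa using hz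
    have hca : ContinuousAt f z := (hf.differentiableAt (isOpen_ball.mem_nhds hzb)).continuousAt
    have h1 : Filter.Tendsto (fun n => (r n : ℂ) * z) Filter.atTop (nhds z) := by
      have := ((Complex.continuous_ofReal.tendsto _).comp hrt).mul_const z
      simpa using this
    exact (hca.tendsto.comp h1).norm
  have h1 : ‖f z‖ ≤ Real.exp (δ * B + ∫ ζ, tl δ K ‖fs ζ‖ ∂(hm z)) :=
    le_of_tendsto_of_tendsto' hfz ((Real.continuous_exp.tendsto _).comp (hint.const_add (δ * B)))
      fun n => step_r hp hf hz hB (hr n) (hBr _ (hr n)) hδ hδ hK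
  have hei : Integrable (fun ζ => Real.exp (p * tl δ K ‖fs ζ‖)) (hm z) := by
    refine Integrable.of_bound
      ((by fun_prop : Continuous fun x : ℝ => Real.exp (p * x)).comp_aestronglyMeasurable htm)
      (Real.exp (p * max |Real.log δ| |K|)) (.of_forall fun ζ => ?_)
    rw [Real.norm_eq_abs, abs_of_pos (Real.exp_pos _)]
    gcongr
    exact (le_abs_self _).trans (tl_bound hδ hK0 _)
  have hJ : Real.exp (p * ∫ ζ, tl δ K ‖fs ζ‖ ∂(hm z)) ≤
      ∫ ζ, Real.exp (p * tl δ K ‖fs ζ‖) ∂(hm z) := by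
    rw [← integral_const_mul]
    exact convexOn_exp.map_integral_le Real.continuous_exp.continuousOn isClosed_univ
      (.of_forall fun _ => mem_univ _) (hti.const_mul p) hei
  have hpm : AEStronglyMeasurable (fun ζ => ‖fs ζ‖ ^ p) (hm z) :=
    (Real.continuous_rpow_const hp.le).comp_aestronglyMeasurable hfsm.norm
  have hpi : Integrable (fun ζ => ‖fs ζ‖ ^ p) (hm z) :=
    (lintegral_ofReal_ne_top_iff_integrable hpm (.of_forall fun _ => by positivity)).1 hI
  have hL : ∫ ζ, Real.exp (p * tl δ K ‖fs ζ‖) ∂(hm z) ≤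
      (∫⁻ ζ, ENNReal.ofReal (‖fs ζ‖ ^ p) ∂(hm z)).toReal + δ ^ p := by
    rw [← integral_eq_lintegral_of_nonneg_ae (.of_forall fun _ => by positivity) hpm]
    calc _ ≤ ∫ ζ, (‖fs ζ‖ ^ p + δ ^ p) ∂(hm z) :=
          integral_mono hei (hpi.add (integrable_const _)) fun ζ =>
            exp_tl_le hp hδ (norm_nonneg _)
      _ = _ := by rw [integral_add hpi (integrable_const _)]; simp
  calc ‖f z‖ ^ p ≤ (Real.exp (δ * B + ∫ ζ, tl δ K ‖fs ζ‖ ∂(hm z))) ^ p := by gcongr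
    _ = Real.exp (p * (δ * B)) * Real.exp (p * ∫ ζ, tl δ K ‖fs ζ‖ ∂(hm z)) := by
      rw [← Real.exp_mul, ← Real.exp_add]; congr 1; ring
    _ ≤ _ := by gcongr; exact hJ.trans hL


/-- If `f ∈ H^p` (`0 < p < ∞`) has boundary function `f*`, then for every `z ∈ 𝔻`,
`|f(z)|^p ≤ ∫_𝕋 |f*(ζ)|^p P_z(ζ) dm(ζ)` where `P_z(ζ) = (1 - |z|²)/|ζ - z|²`. -/
theorem poisson_bound (p : ℝ) (hp : 0 < p)
    (f fs : ℂ → ℂ)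
    (hf : DifferentiableOn ℂ f (Metric.ball (0 : ℂ) 1))
    (hHp : hardyNorm p f ≠ ⊤)
    (hbd : IsBoundaryFn f fs)
    (z : ℂ) (hz : z ∈ Metric.ball (0 : ℂ) 1) :
    ENNReal.ofReal (‖f z‖ ^ p) ≤
      ∫⁻ ζ, ENNReal.ofReal (‖fs ζ‖ ^ p *
        ((1 - ‖z‖ ^ 2) / ‖ζ - z‖ ^ 2)) ∂circleMeasure := by
  have hz' : ‖z‖ < 1 := by simpa using hz
  have hR : ∫⁻ ζ, ENNReal.ofReal (‖fs ζ‖ ^ p * ((1 - ‖z‖ ^ 2) / ‖ζ - z‖ ^ 2)) ∂circleMeasure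
      = ∫⁻ ζ, ENNReal.ofReal (‖fs ζ‖ ^ p) ∂(hm z) := by
    unfold hm
    rw [lintegral_withDensity_eq_lintegral_mul_non_measurable _
      (by have := pk_measurable z; fun_prop) (.of_forall (by simp))]
    refine lintegral_congr fun ζ => ?_
    rw [mul_comm, Pi.mul_apply, ← ENNReal.ofReal_mul (pk_nonneg hz' ζ)]
    rfl
  rw [hR]
  by_cases hI : ∫⁻ ζ, ENNReal.ofReal (‖fs ζ‖ ^ p) ∂(hm z) = ⊤
  · rw [hI]; exact le_top
  obtain ⟨C, hC0, hC⟩ := hm_bound hz'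
  have hBr : ∀ r ∈ Ioo (0:ℝ) 1, ∫⁻ ζ, ENNReal.ofReal (‖f (↑r * ζ)‖ ^ p) ∂(hm z) ≤
      ENNReal.ofReal (C * (hardyNorm p f).toReal) := by
    intro r hr
    refine (hC _).trans ?_
    rw [ENNReal.ofReal_mul hC0, ENNReal.ofReal_toReal hHp]
    gcongr
    unfold hardyNorm
    exact le_iSup₂ (f := fun (r : ℝ) (_ : r ∈ Set.Ioo (0 : ℝ) 1) =>
      ∫⁻ ζ, ENNReal.ofReal (‖f (↑r * ζ)‖ ^ p) ∂circleMeasure) r hr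
  set B := C * (hardyNorm p f).toReal with hBdef
  have hB : 0 ≤ B := by positivity
  rw [ENNReal.ofReal_le_iff_le_toReal hI]
  set J := (∫⁻ ζ, ENNReal.ofReal (‖fs ζ‖ ^ p) ∂(hm z)).toReal with hJ
  have hc : Continuous (fun δ : ℝ => Real.exp (p * (δ * B)) * (J + δ ^ p)) :=
    (by fun_prop : Continuous fun δ : ℝ => Real.exp (p * (δ * B))).mul
      (continuous_const.add (Real.continuous_rpow_const hp.le))
  have ht := (hc.tendsto 0).mono_left (nhdsWithin_le_nhds (s := Ioi 0))
  simp only [zero_mul, mul_zero, Real.exp_zero, one_mul, Real.zero_rpow hp.ne', add_zero] at ht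
  refine ge_of_tendsto ht ?_
  filter_upwards [self_mem_nhdsWithin] with δ hδ
  exact step_lim hp hf hbd hz' hB hBr hδ hI
end

section
/- (Theorem 1, case p = ∞.) Let f ∈ H^∞ have a boundary function f* with Λ(f) < ∞ (i.e. f ∈ 𝔑). Then the Toeplitz operator T_f is bounded on H^∞: for every h ∈ H^∞ with boundary function h*, the function T_f h is analytic and bounded on 𝔻 and ‖T_f h‖_{H^∞} ≤ (‖f‖_{H^∞} + Λ(f)) · ‖h‖_{H^∞}. -/
open MeasureTheory Complex Metric Set
open scoped ENNReal

namespace ToepAux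

open Filter Topology

theorem meas_exp : Measurable (fun θ : ℝ => Complex.exp (θ * Complex.I)) := by fun_prop

instance instProb : IsProbabilityMeasure circleMeasure := by
  unfold circleMeasure
  have : IsProbabilityMeasure ((ENNReal.ofReal (2 * Real.pi))⁻¹ •
      (volume : Measure ℝ).restrict (Set.Ioc 0 (2 * Real.pi))) := by
    constructor
    simp only [Measure.smul_apply, Measure.restrict_apply_univ, Real.volume_Ioc, sub_zero,
      smul_eq_mul]
    apply ENNReal.inv_mul_cancel
    · simp [Real.pi_pos]
    · exact ENNReal.ofReal_ne_top
  exact Measure.isProbabilityMeasure_map meas_exp.aemeasurable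

theorem ae_norm : ∀ᵐ ζ ∂circleMeasure, ‖ζ‖ = 1 := by
  unfold circleMeasure
  rw [ae_map_iff meas_exp.aemeasurable (measurableSet_eq_fun measurable_norm measurable_const)]
  exact Eventually.of_forall fun θ => Complex.norm_exp_ofReal_mul_I θ

theorem aesm_of_cont {g : ℂ → ℂ} (hg : ContinuousOn g (closedBall 0 1)) :
    AEStronglyMeasurable g circleMeasure := by
  have h1 : circleMeasure.restrict (closedBall 0 1) = circleMeasure := by
    apply Measure.restrict_eq_self_of_ae_mem
    filter_upwards [ae_norm] with ζ hζ
    simp [hζ]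
  rw [← h1]
  exact hg.aestronglyMeasurable measurableSet_closedBall

theorem aesm_kernel (z : ℂ) :
    AEStronglyMeasurable (fun ζ : ℂ => (1 - (starRingEnd ℂ) ζ * z)) circleMeasure := by
  apply Continuous.aestronglyMeasurable
  fun_prop

theorem aesm_div {φ : ℂ → ℂ} (hφ : AEStronglyMeasurable φ circleMeasure) (z : ℂ) :
    AEStronglyMeasurable (fun ζ => φ ζ / (1 - (starRingEnd ℂ) ζ * z)) circleMeasure :=
  (hφ.aemeasurable.div (aesm_kernel z).aemeasurable).aestronglyMeasurable

theorem integral_cm {φ : ℂ → ℂ} (hφ : AEStronglyMeasurable φ circleMeasure) :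
    ∫ ζ, φ ζ ∂circleMeasure =
      (2 * Real.pi : ℝ)⁻¹ • ∫ θ in (0:ℝ)..(2 * Real.pi), φ (Complex.exp (θ * I)) := by
  unfold circleMeasure at *
  rw [integral_map meas_exp.aemeasurable hφ, integral_smul_measure,
    intervalIntegral.integral_of_le Real.two_pi_pos.le, ENNReal.toReal_inv,
    ENNReal.toReal_ofReal Real.two_pi_pos.le]

theorem norm_kernel {ζ : ℂ} (hζ : ‖ζ‖ = 1) (z : ℂ) :
    ‖1 - (starRingEnd ℂ) ζ * z‖ = ‖ζ - z‖ := by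
  have h1 : ζ * (starRingEnd ℂ) ζ = 1 := by
    rw [Complex.mul_conj, Complex.normSq_eq_norm_sq, hζ]; simp
  have : ζ - z = ζ * (1 - (starRingEnd ℂ) ζ * z) := by
    linear_combination z * h1
  rw [this, norm_mul, hζ, one_mul]

theorem cauchy_eq {φ : ℂ → ℂ} (hφ : AEStronglyMeasurable φ circleMeasure) (z : ℂ) :
    ∫ ζ, φ ζ / (1 - (starRingEnd ℂ) ζ * z) ∂circleMeasure =
      (2 * Real.pi * I : ℂ)⁻¹ • ∮ ζ in C(0, 1), (ζ - z)⁻¹ • φ ζ := by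
  rw [integral_cm (aesm_div hφ z), circleIntegral]
  have : ∀ θ : ℝ, deriv (circleMap 0 1) θ • (circleMap 0 1 θ - z)⁻¹ • φ (circleMap 0 1 θ)
      = I * (φ (Complex.exp (θ * I)) / (1 - (starRingEnd ℂ) (Complex.exp (θ * I)) * z)) := by
    intro θ
    have e : circleMap 0 1 θ = Complex.exp (θ * I) := by simp [circleMap]
    have hζ : ‖Complex.exp (θ * I)‖ = 1 := Complex.norm_exp_ofReal_mul_I θ
    rw [deriv_circleMap, e]
    set ζ := Complex.exp (θ * I)
    have h1 : ζ * (starRingEnd ℂ) ζ = 1 := by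
      rw [Complex.mul_conj, Complex.normSq_eq_norm_sq, hζ]; simp
    have h0 : ζ ≠ 0 := by intro h; simp [h] at hζ
    have : ζ - z = ζ * (1 - (starRingEnd ℂ) ζ * z) := by
      linear_combination z * h1
    rw [this, mul_inv]
    simp only [smul_eq_mul]
    field_simp
  simp_rw [this]
  rw [intervalIntegral.integral_const_mul]
  simp only [Complex.real_smul, smul_eq_mul]
  push_cast
  generalize (∫ θ in (0:ℝ)..(2 * Real.pi), φ (Complex.exp (θ * I)) /
    (1 - (starRingEnd ℂ) (Complex.exp (θ * I)) * z)) = J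
  have := Complex.I_ne_zero
  field_simp

theorem cauchy_formula {g : ℂ → ℂ} (hg : ContinuousOn g (closedBall 0 1))
    (hd : DifferentiableOn ℂ g (ball 0 1)) {z : ℂ} (hz : z ∈ ball (0:ℂ) 1) :
    ∫ ζ, g ζ / (1 - (starRingEnd ℂ) ζ * z) ∂circleMeasure = g z := by
  rw [cauchy_eq (aesm_of_cont hg)]
  exact Complex.two_pi_I_inv_smul_circleIntegral_sub_inv_smul_of_differentiable_on_off_countable
    countable_empty hz hg (fun x hx => hd.differentiableAt (isOpen_ball.mem_nhds hx.1))

theorem cauchy_diff {φ : ℂ → ℂ} (hφ : Integrable φ circleMeasure) :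
    DifferentiableOn ℂ (fun z => ∫ ζ, φ ζ / (1 - (starRingEnd ℂ) ζ * z) ∂circleMeasure)
      (ball 0 1) := by
  have hc : CircleIntegrable φ 0 1 := by
    unfold CircleIntegrable
    rw [intervalIntegrable_iff_integrableOn_Ioc_of_le Real.two_pi_pos.le]
    have h1 := hφ
    unfold circleMeasure at h1
    rw [integrable_map_measure (by simpa [circleMeasure] using hφ.1) meas_exp.aemeasurable,
      integrable_smul_measure (ENNReal.inv_ne_zero.2 ENNReal.ofReal_ne_top)
        (by simp [Real.pi_pos])] at h1
    have e : (fun θ : ℝ => φ (circleMap 0 1 θ)) =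
      φ ∘ (fun θ : ℝ => Complex.exp (θ * Complex.I)) := by
      ext θ; simp [circleMap]
    rw [e]
    exact h1
  simp_rw [cauchy_eq hφ.1]
  have := (hasFPowerSeriesOn_cauchy_integral (R := 1) (c := 0) (f := φ)
    (by simpa using hc) one_pos).differentiableOn
  have e : Metric.eball (0:ℂ) ((1 : NNReal) : ℝ≥0∞) = ball 0 1 := by
    rw [Metric.eball_coe]; rfl
  rw [e] at this
  simpa using this

theorem le_sup {f : ℂ → ℂ} (hfb : eSupAbs f ≠ ⊤) {z : ℂ} (hz : z ∈ ball (0:ℂ) 1) :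
    ‖f z‖ ≤ (eSupAbs f).toReal := by
  rw [← ENNReal.ofReal_le_iff_le_toReal hfb]
  exact le_iSup₂_of_le (f := fun z (_ : z ∈ ball (0:ℂ) 1) => ENNReal.ofReal ‖f z‖) z hz le_rfl

theorem ev_Ioo : ∀ᶠ r : ℝ in 𝓝[<] 1, r ∈ Ioo (0:ℝ) 1 := Ioo_mem_nhdsLT one_pos

theorem mem_ball_mul {r : ℝ} (hr : r ∈ Ioo (0:ℝ) 1) {ζ : ℂ} (hζ : ‖ζ‖ ≤ 1) :
    (r : ℂ) * ζ ∈ ball (0:ℂ) 1 := by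
  simp only [mem_ball, dist_zero_right, norm_mul, Complex.norm_real, Real.norm_eq_abs,
    abs_of_pos hr.1]
  nlinarith [hr.1, hr.2]

theorem dil_cont {f : ℂ → ℂ} (hf : DifferentiableOn ℂ f (ball 0 1)) {r : ℝ}
    (hr : r ∈ Ioo (0:ℝ) 1) : ContinuousOn (fun ζ => f (r * ζ)) (closedBall 0 1) :=
  hf.continuousOn.comp (by fun_prop) (fun ζ hζ => mem_ball_mul hr (by simpa using hζ))

theorem dil_diff {f : ℂ → ℂ} (hf : DifferentiableOn ℂ f (ball 0 1)) {r : ℝ}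
    (hr : r ∈ Ioo (0:ℝ) 1) : DifferentiableOn ℂ (fun ζ => f (r * ζ)) (ball 0 1) :=
  hf.comp (by fun_prop)
    (fun ζ hζ => mem_ball_mul hr (by simpa using (ball_subset_closedBall hζ)))

theorem bd_aesm {f fs : ℂ → ℂ} (hf : DifferentiableOn ℂ f (ball 0 1))
    (hbf : IsBoundaryFn f fs) : AEStronglyMeasurable fs circleMeasure := by
  obtain ⟨u, -, hu, hu1⟩ := exists_seq_strictMono_tendsto' (zero_lt_one (α := ℝ))
  have hu' : Tendsto u atTop (𝓝[<] 1) :=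
    tendsto_nhdsWithin_iff.2 ⟨hu1, Eventually.of_forall fun n => (hu n).2⟩
  refine aestronglyMeasurable_of_tendsto_ae atTop
    (f := fun n ζ => f (u n * ζ)) (fun n => aesm_of_cont (dil_cont hf (hu n))) ?_
  filter_upwards [hbf] with ζ hζ
  exact hζ.comp hu'

theorem bd_le {f fs : ℂ → ℂ} (hfb : eSupAbs f ≠ ⊤) (hbf : IsBoundaryFn f fs) :
    ∀ᵐ ζ ∂circleMeasure, ‖fs ζ‖ ≤ (eSupAbs f).toReal := by
  filter_upwards [hbf, ae_norm] with ζ hζ h1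
  refine le_of_tendsto hζ.norm ?_
  filter_upwards [ev_Ioo] with r hr
  exact le_sup hfb (mem_ball_mul hr h1.le)

theorem kernel_lower {ζ z : ℂ} (hζ : ‖ζ‖ = 1) :
    1 - ‖z‖ ≤ ‖1 - (starRingEnd ℂ) ζ * z‖ := by
  rw [norm_kernel hζ, ← hζ]; exact norm_sub_norm_le _ _

theorem cauchy_bd {h hs : ℂ → ℂ} (hh : DifferentiableOn ℂ h (ball 0 1))
    (hhb : eSupAbs h ≠ ⊤) (hbh : IsBoundaryFn h hs) {z : ℂ} (hz : z ∈ ball (0:ℂ) 1) :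
    ∫ ζ, hs ζ / (1 - (starRingEnd ℂ) ζ * z) ∂circleMeasure = h z := by
  have hz1 : ‖z‖ < 1 := by simpa using hz
  have t1 : Tendsto (fun r : ℝ => ∫ ζ, h (r * ζ) / (1 - (starRingEnd ℂ) ζ * z) ∂circleMeasure)
      (𝓝[<] 1) (𝓝 (∫ ζ, hs ζ / (1 - (starRingEnd ℂ) ζ * z) ∂circleMeasure)) := by
    refine tendsto_integral_filter_of_dominated_convergence
      (fun _ => (eSupAbs h).toReal / (1 - ‖z‖)) ?_ ?_ (integrable_const _) ?_
    · filter_upwards [ev_Ioo] with r hr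
      exact aesm_div (aesm_of_cont (dil_cont hh hr)) z
    · filter_upwards [ev_Ioo] with r hr
      filter_upwards [ae_norm] with ζ hζ
      rw [norm_div]
      exact div_le_div₀ ENNReal.toReal_nonneg (le_sup hhb (mem_ball_mul hr hζ.le))
        (by linarith) (kernel_lower hζ)
    · filter_upwards [hbh] with ζ hζ
      exact hζ.div_const _
  have t2 : Tendsto (fun r : ℝ => h (r * z)) (𝓝[<] 1) (𝓝 (h z)) := by
    have hc : ContinuousAt h ((1:ℝ) * z) := by
      simpa using (hh.differentiableAt (isOpen_ball.mem_nhds hz)).continuousAt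
    have : ContinuousAt (fun r : ℝ => h (r * z)) 1 :=
      ContinuousAt.comp (f := fun r : ℝ => (r : ℂ) * z) (g := h) hc (by fun_prop)
    have := this.tendsto.mono_left (nhdsWithin_le_nhds (s := Iio 1))
    simpa using this
  refine tendsto_nhds_unique t1 (t2.congr' ?_)
  filter_upwards [ev_Ioo] with r hr
  exact (cauchy_formula (dil_cont hh hr) (dil_diff hh hr) hz).symm

/-- A maximum principle for radial limits. -/
theorem max_principle {G L : ℂ → ℂ} {C M : ℝ} (hG : DifferentiableOn ℂ G (ball 0 1))
    (hM0 : 0 ≤ M)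
    (hC : ∀ᵐ η ∂circleMeasure, ∀ r ∈ Ioo (0:ℝ) 1, ‖G (r * η)‖ ≤ C)
    (hL : ∀ᵐ η ∂circleMeasure, Tendsto (fun r : ℝ => G (r * η)) (𝓝[<] 1) (𝓝 (L η)))
    (hM : ∀ᵐ η ∂circleMeasure, ‖L η‖ ≤ M) {z : ℂ} (hz : z ∈ ball (0:ℂ) 1) : ‖G z‖ ≤ M := by
  have hz1 : ‖z‖ < 1 := by simpa using hz
  have hz2 : 0 < 1 - ‖z‖ := by linarith
  have key : ∀ n : ℕ, ‖G z‖ ^ n ≤ M ^ n / (1 - ‖z‖) := by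
    intro n
    have t1 : Tendsto (fun r : ℝ => ∫ ζ, G (r * ζ) ^ n / (1 - (starRingEnd ℂ) ζ * z)
        ∂circleMeasure) (𝓝[<] 1)
        (𝓝 (∫ ζ, L ζ ^ n / (1 - (starRingEnd ℂ) ζ * z) ∂circleMeasure)) := by
      refine tendsto_integral_filter_of_dominated_convergence
        (fun _ => C ^ n / (1 - ‖z‖)) ?_ ?_ (integrable_const _) ?_
      · filter_upwards [ev_Ioo] with r hr
        exact aesm_div (aesm_of_cont ((dil_cont hG hr).pow n)) z
      · filter_upwards [ev_Ioo] with r hr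
        filter_upwards [ae_norm, hC] with ζ hζ hc
        rw [norm_div, norm_pow]
        have := hc r hr
        have h0 : 0 ≤ C := (norm_nonneg _).trans this
        exact div_le_div₀ (by positivity) (pow_le_pow_left₀ (norm_nonneg _) this n)
          hz2 (kernel_lower hζ)
      · filter_upwards [hL] with ζ hζ
        exact (hζ.pow n).div_const _
    have t2 : Tendsto (fun r : ℝ => G (r * z) ^ n) (𝓝[<] 1) (𝓝 (G z ^ n)) := by
      have hc : ContinuousAt G ((1:ℝ) * z) := by
        simpa using (hG.differentiableAt (isOpen_ball.mem_nhds hz)).continuousAt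
      have : ContinuousAt (fun r : ℝ => G (r * z)) 1 :=
        ContinuousAt.comp (f := fun r : ℝ => (r : ℂ) * z) (g := G) hc (by fun_prop)
      have := this.tendsto.mono_left (nhdsWithin_le_nhds (s := Iio 1))
      simpa using this.pow n
    have e : G z ^ n = ∫ ζ, L ζ ^ n / (1 - (starRingEnd ℂ) ζ * z) ∂circleMeasure := by
      refine tendsto_nhds_unique t2 (t1.congr' ?_)
      filter_upwards [ev_Ioo] with r hr
      exact cauchy_formula ((dil_cont hG hr).pow n) ((dil_diff hG hr).pow n) hz
    rw [← norm_pow, e]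
    have := norm_integral_le_of_norm_le_const (μ := circleMeasure)
      (f := fun ζ => L ζ ^ n / (1 - (starRingEnd ℂ) ζ * z)) (C := M ^ n / (1 - ‖z‖)) (by
        filter_upwards [ae_norm, hM] with ζ hζ hm
        rw [norm_div, norm_pow]
        exact div_le_div₀ (by positivity) (pow_le_pow_left₀ (norm_nonneg _) hm n)
          hz2 (kernel_lower hζ))
    simpa using this
  by_contra! hlt
  have hx : 0 < ‖G z‖ := hM0.trans_lt hlt
  have ht := tendsto_pow_atTop_nhds_zero_of_lt_one (div_nonneg hM0 hx.le)
    ((div_lt_one hx).2 hlt)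
  obtain ⟨n, hn⟩ := (ht.eventually (gt_mem_nhds hz2)).exists
  have := key n
  rw [le_div_iff₀ hz2] at this
  rw [div_pow, div_lt_iff₀ (by positivity)] at hn
  linarith [mul_comm (‖G z‖ ^ n) (1 - ‖z‖)]

theorem half_lower {ζ η : ℂ} (hζ : ‖ζ‖ = 1) (hη : ‖η‖ = 1) {r : ℝ} (hr : r ∈ Ioo (0:ℝ) 1) :
    ‖ζ - η‖ ≤ 2 * ‖ζ - r * η‖ := by
  have h1 : ‖(r:ℂ) * η‖ = r := by
    rw [norm_mul, hη, Complex.norm_real, Real.norm_eq_abs, abs_of_pos hr.1, mul_one]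
  have h2 : ‖(r:ℂ) * η - η‖ = 1 - r := by
    have : (r:ℂ) * η - η = ((r - 1 : ℝ) : ℂ) * η := by push_cast; ring
    rw [this, norm_mul, hη, Complex.norm_real, Real.norm_eq_abs, abs_of_neg (by linarith [hr.2])]
    ring
  have h3 : ‖ζ‖ - ‖(r:ℂ) * η‖ ≤ ‖ζ - r * η‖ := norm_sub_norm_le _ _
  have h4 : ‖ζ - η‖ ≤ ‖ζ - r * η‖ + ‖(r:ℂ) * η - η‖ := norm_sub_le_norm_sub_add_norm_sub _ _ _
  rw [h1, hζ] at h3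
  linarith

theorem pointwise {f fs h hs : ℂ → ℂ}
    (hfm : AEStronglyMeasurable fs circleMeasure)
    (hhm : AEStronglyMeasurable hs circleMeasure) {A B Λ : ℝ}
    (hA : ∀ᵐ ζ ∂circleMeasure, ‖fs ζ‖ ≤ A)
    (hB : ∀ᵐ ζ ∂circleMeasure, ‖hs ζ‖ ≤ B) (hB0 : 0 ≤ B) (hΛ0 : 0 ≤ Λ)
    (hBh : ∀ z ∈ ball (0:ℂ) 1, ‖h z‖ ≤ B)
    (hc : ∀ z ∈ ball (0:ℂ) 1,
      ∫ ζ, hs ζ / (1 - (starRingEnd ℂ) ζ * z) ∂circleMeasure = h z)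
    {η : ℂ} (hη : ‖η‖ = 1) (hAη : ‖fs η‖ ≤ A) (hBη : ‖hs η‖ ≤ B)
    (hlim : Tendsto (fun r : ℝ => h (r * η)) (𝓝[<] 1) (𝓝 (hs η)))
    (hI : ∫⁻ ζ, ENNReal.ofReal (‖fs ζ - fs η‖ / ‖ζ - η‖) ∂circleMeasure ≤ ENNReal.ofReal Λ) :
    (∀ r ∈ Ioo (0:ℝ) 1, ‖toeplitz fs hs (r * η)‖ ≤ 2 * Λ * B + A * B) ∧
    ∃ l : ℂ, Tendsto (fun r : ℝ => toeplitz fs hs (r * η)) (𝓝[<] 1) (𝓝 l) ∧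
      ‖l‖ ≤ (A + Λ) * B := by
  have hA0 : 0 ≤ A := (norm_nonneg _).trans hAη
  set w : ℂ → ℝ := fun ζ => ‖fs ζ - fs η‖ / ‖ζ - η‖ with hw
  have hw0 : ∀ ζ, 0 ≤ w ζ := fun ζ => by positivity
  have hwm : AEStronglyMeasurable w circleMeasure := by
    have h1 : AEMeasurable (fun ζ => ‖fs ζ - fs η‖) circleMeasure :=
      (hfm.aemeasurable.sub_const _).norm
    have h2 : AEMeasurable (fun ζ : ℂ => ‖ζ - η‖) circleMeasure := by fun_prop
    exact (h1.div h2).aestronglyMeasurable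
  have hwi : Integrable w circleMeasure := by
    refine ⟨hwm, ?_⟩
    rw [hasFiniteIntegral_iff_ofReal (Eventually.of_forall hw0)]
    exact hI.trans_lt ENNReal.ofReal_lt_top
  have hwle : ∫ ζ, w ζ ∂circleMeasure ≤ Λ := by
    rw [integral_eq_lintegral_of_nonneg_ae (Eventually.of_forall hw0) hwm]
    exact ENNReal.toReal_le_of_le_ofReal hΛ0 hI
  set D : ℂ → ℂ → ℂ := fun z ζ =>
    (starRingEnd ℂ) (fs ζ - fs η) * hs ζ / (1 - (starRingEnd ℂ) ζ * z) with hD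
  have hconj : ∀ {g : ℂ → ℂ}, AEStronglyMeasurable g circleMeasure →
      AEStronglyMeasurable (fun ζ => (starRingEnd ℂ) (g ζ)) circleMeasure := fun hg =>
    Complex.continuous_conj.comp_aestronglyMeasurable hg
  have hDm : ∀ z, AEStronglyMeasurable (D z) circleMeasure := fun z =>
    aesm_div ((hconj (hfm.sub aestronglyMeasurable_const)).mul hhm) z
  have hDb : ∀ r ∈ Ioo (0:ℝ) 1, ∀ᵐ ζ ∂circleMeasure, ‖D (r * η) ζ‖ ≤ w ζ * (2 * B) := by
    intro r hr
    filter_upwards [ae_norm, hB] with ζ hζ hb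
    simp only [hD, hw]
    rw [norm_div, norm_mul, RCLike.norm_conj, norm_kernel hζ]
    rcases eq_or_ne ζ η with rfl | hne
    · simp
    have h1 : 0 < ‖ζ - η‖ := norm_pos_iff.2 (sub_ne_zero.2 hne)
    have h2 := half_lower hζ hη hr
    have h3 : 0 < ‖ζ - r * η‖ := by linarith
    rw [div_mul_eq_mul_div, div_le_div_iff₀ h3 h1]
    calc ‖fs ζ - fs η‖ * ‖hs ζ‖ * ‖ζ - η‖
        ≤ ‖fs ζ - fs η‖ * B * (2 * ‖ζ - r * η‖) := by gcongr
      _ = _ := by ring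
  have hD1 : ∀ᵐ ζ ∂circleMeasure, ‖D η ζ‖ ≤ w ζ * B := by
    filter_upwards [ae_norm, hB] with ζ hζ hb
    simp only [hD, hw]
    rw [norm_div, norm_mul, RCLike.norm_conj, norm_kernel hζ, div_mul_eq_mul_div]
    gcongr
  have hT : ∀ r ∈ Ioo (0:ℝ) 1, toeplitz fs hs (r * η) =
      (∫ ζ, D (r * η) ζ ∂circleMeasure) + (starRingEnd ℂ) (fs η) * h (r * η) := by
    intro r hr
    have hz := mem_ball_mul hr hη.le
    have hz1 : ‖(r:ℂ) * η‖ < 1 := by simpa using hz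
    rw [← hc _ hz, ← integral_const_mul, ← integral_add]
    · unfold toeplitz
      congr 1
      ext ζ
      simp only [hD, map_sub]
      ring
    · exact (hwi.mul_const (2 * B)).mono' (hDm _) (hDb r hr)
    · refine Integrable.const_mul ?_ _
      refine Integrable.of_bound (aesm_div hhm _) (B / (1 - ‖(r:ℂ) * η‖)) ?_
      filter_upwards [ae_norm, hB] with ζ hζ hb
      rw [norm_div]
      exact div_le_div₀ hB0 hb (by linarith) (kernel_lower hζ)
  refine ⟨?_, (∫ ζ, D η ζ ∂circleMeasure) + (starRingEnd ℂ) (fs η) * hs η, ?_, ?_⟩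
  · intro r hr
    rw [hT r hr]
    refine (norm_add_le _ _).trans (add_le_add ?_ ?_)
    · refine (norm_integral_le_of_norm_le (hwi.mul_const (2 * B)) (hDb r hr)).trans ?_
      rw [integral_mul_const]
      nlinarith
    · rw [norm_mul, RCLike.norm_conj]
      exact mul_le_mul hAη (hBh _ (mem_ball_mul hr hη.le)) (norm_nonneg _) hA0
  · have t : Tendsto (fun r : ℝ => ∫ ζ, D (r * η) ζ ∂circleMeasure) (𝓝[<] 1)
        (𝓝 (∫ ζ, D η ζ ∂circleMeasure)) := by
      refine tendsto_integral_filter_of_dominated_convergence (fun ζ => w ζ * (2 * B))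
        (Eventually.of_forall fun r => hDm _) ?_ (hwi.mul_const (2 * B)) ?_
      · filter_upwards [ev_Ioo] with r hr using hDb r hr
      · filter_upwards [ae_norm] with ζ hζ
        rcases eq_or_ne ζ η with rfl | hne
        · simp [hD]
        have h1 : 1 - (starRingEnd ℂ) ζ * (((1:ℝ) : ℂ) * η) ≠ 0 := by
          rw [← norm_pos_iff, norm_kernel hζ]
          simpa [sub_eq_zero] using hne
        have : ContinuousAt (fun r : ℝ => D (r * η) ζ) 1 := by
          simp only [hD]
          exact ContinuousAt.div (by fun_prop) (by fun_prop) h1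
        have := this.tendsto.mono_left (nhdsWithin_le_nhds (s := Iio 1))
        simpa using this
    refine (t.add (hlim.const_mul ((starRingEnd ℂ) (fs η)))).congr' ?_
    filter_upwards [ev_Ioo] with r hr
    exact (hT r hr).symm
  · rw [add_comm A, add_mul]
    refine (norm_add_le _ _).trans (add_le_add ?_ ?_)
    · refine (norm_integral_le_of_norm_le (hwi.mul_const B) hD1).trans ?_
      rw [integral_mul_const]
      gcongr
    · rw [norm_mul, RCLike.norm_conj]
      exact mul_le_mul hAη hBη (norm_nonneg _) hA0

end ToepAux

/-- **Theorem 1, case p = ∞.** If `f ∈ H^∞` has boundary function `f*` with `Λ(f) < ∞`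
(i.e. `f ∈ 𝔑`), then for every `h ∈ H^∞` with boundary function `h*`, the function `T_f h` is
analytic and bounded on `𝔻` and `‖T_f h‖_{H^∞} ≤ (‖f‖_{H^∞} + Λ(f)) ‖h‖_{H^∞}`. -/
theorem toeplitz_bounded_Hinf (f fs : ℂ → ℂ)
    (hf : DifferentiableOn ℂ f (Metric.ball (0 : ℂ) 1))
    (hfb : eSupAbs f ≠ ⊤)
    (hbf : IsBoundaryFn f fs)
    (hΛ : Lam fs ≠ ⊤)
    (h hs : ℂ → ℂ)
    (hh : DifferentiableOn ℂ h (Metric.ball (0 : ℂ) 1))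
    (hhb : eSupAbs h ≠ ⊤)
    (hbh : IsBoundaryFn h hs) :
    DifferentiableOn ℂ (toeplitz fs hs) (Metric.ball (0 : ℂ) 1) ∧
      eSupAbs (toeplitz fs hs) ≤ (eSupAbs f + Lam fs) * eSupAbs h := by
  have hfm := ToepAux.bd_aesm hf hbf
  have hhm := ToepAux.bd_aesm hh hbh
  have hA := ToepAux.bd_le hfb hbf
  have hB := ToepAux.bd_le hhb hbh
  have hdiff : DifferentiableOn ℂ (toeplitz fs hs) (Metric.ball (0 : ℂ) 1) := by
    refine ToepAux.cauchy_diff (φ := fun ζ => (starRingEnd ℂ) (fs ζ) * hs ζ) ?_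
    refine Integrable.of_bound
      ((Complex.continuous_conj.comp_aestronglyMeasurable hfm).mul hhm)
      ((eSupAbs f).toReal * (eSupAbs h).toReal) ?_
    filter_upwards [hA, hB] with ζ ha hb
    rw [norm_mul, RCLike.norm_conj]
    exact mul_le_mul ha hb (norm_nonneg _) ENNReal.toReal_nonneg
  refine ⟨hdiff, ?_⟩
  have key : ∀ᵐ η ∂circleMeasure,
      (∀ r ∈ Ioo (0:ℝ) 1, ‖toeplitz fs hs (r * η)‖ ≤
        2 * (Lam fs).toReal * (eSupAbs h).toReal + (eSupAbs f).toReal * (eSupAbs h).toReal) ∧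
      ∃ l : ℂ, Filter.Tendsto (fun r : ℝ => toeplitz fs hs (r * η))
        (nhdsWithin 1 (Set.Iio 1)) (nhds l) ∧
        ‖l‖ ≤ ((eSupAbs f).toReal + (Lam fs).toReal) * (eSupAbs h).toReal := by
    have hI : ∀ᵐ η ∂circleMeasure,
        ∫⁻ ζ, ENNReal.ofReal (‖fs ζ - fs η‖ / ‖ζ - η‖) ∂circleMeasure ≤ Lam fs :=
      ENNReal.ae_le_essSup _
    filter_upwards [hA, hB, ToepAux.ae_norm, hbh, hI] with η ha hb h1 hl hi
    exact ToepAux.pointwise (f := f) hfm hhm hA hB ENNReal.toReal_nonneg ENNReal.toReal_nonneg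
      (fun z hz => ToepAux.le_sup hhb hz) (fun z hz => ToepAux.cauchy_bd hh hhb hbh hz)
      h1 ha hb hl (by rwa [ENNReal.ofReal_toReal hΛ])
  classical
  have hchoice : ∃ L : ℂ → ℂ, ∀ᵐ η ∂circleMeasure,
      Filter.Tendsto (fun r : ℝ => toeplitz fs hs (r * η))
        (nhdsWithin 1 (Set.Iio 1)) (nhds (L η)) ∧
        ‖L η‖ ≤ ((eSupAbs f).toReal + (Lam fs).toReal) * (eSupAbs h).toReal := by
    have := key.mono fun η hη => hη.2
    exact Filter.Eventually.choice this
  obtain ⟨L, hL⟩ := hchoice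
  have hfin : ∀ z ∈ ball (0:ℂ) 1, ‖toeplitz fs hs z‖ ≤
      ((eSupAbs f).toReal + (Lam fs).toReal) * (eSupAbs h).toReal := fun z hz =>
    ToepAux.max_principle hdiff (by positivity) (key.mono fun η hη => hη.1)
      (hL.mono fun η hη => hη.1) (hL.mono fun η hη => hη.2) hz
  refine iSup₂_le fun z hz => ?_
  refine (ENNReal.ofReal_le_ofReal (hfin z hz)).trans (le_of_eq ?_)
  rw [ENNReal.ofReal_mul (by positivity), ENNReal.ofReal_add (by positivity) (by positivity),
    ENNReal.ofReal_toReal hfb, ENNReal.ofReal_toReal hΛ, ENNReal.ofReal_toReal hhb]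
end

section
/- Let f ∈ H^∞ have a boundary function f*, let ζ ∈ 𝕋, and let w ∈ ℂ be such that C := ∫_𝕋 |f*(η) − w|/|η − ζ| dm(η) < ∞. Then the function F(z) = (w − f(z))/(ζ − z), which is analytic on 𝔻, belongs to H^1 and ‖F‖_{H^1} ≤ C. -/
open MeasureTheory Complex Metric Set
open scoped ENNReal

open Filter Topology in
lemma aux_poisson_symm (r R α θ : ℝ) :
    poissonKernel 0 (r * exp (α * I)) (R * exp (θ * I)) =
      poissonKernel 0 (r * exp (θ * I)) (R * exp (α * I)) := by
  have key : ∀ a b : ℝ, ‖(R:ℂ) * exp (a * I) - r * exp (b * I)‖ ^ 2 =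
      R ^ 2 + r ^ 2 - 2 * R * r * Real.cos (a - b) := by
    intro a b
    rw [← Complex.normSq_eq_norm_sq, Complex.normSq_apply, Real.cos_sub]
    simp only [exp_ofReal_mul_I, sub_re, sub_im, mul_re, mul_im, add_re, add_im, ofReal_re,
      ofReal_im, I_re, I_im]
    linear_combination R ^ 2 * Real.sin_sq_add_cos_sq a + r ^ 2 * Real.sin_sq_add_cos_sq b
  simp only [poissonKernel_def, sub_zero, key, norm_mul, norm_exp_ofReal_mul_I]
  rw [← Real.cos_neg (θ - α), neg_sub]

lemma aux_poisson_nonneg (r R α θ : ℝ) (hr : 0 < r) (hR : r < R) :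
    0 ≤ poissonKernel 0 (r * exp (α * I)) (R * exp (θ * I)) := by
  simp only [poissonKernel_def, sub_zero, norm_mul, norm_exp_ofReal_mul_I, norm_real, mul_one,
    Real.norm_eq_abs, sq_abs]
  apply div_nonneg _ (by positivity)
  nlinarith

lemma aux_poisson_cont (r R : ℝ) (hr : 0 < r) (hR : r < R) :
    Continuous (fun p : ℝ × ℝ =>
      poissonKernel 0 (r * exp (p.1 * I)) (R * exp (p.2 * I))) := by
  simp only [poissonKernel_def, sub_zero]
  apply Continuous.div (by fun_prop) (by fun_prop)
  intro p h
  have h1 : (R : ℂ) * exp (p.2 * I) = r * exp (p.1 * I) := by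
    have := pow_eq_zero_iff (two_ne_zero) |>.1 h
    exact sub_eq_zero.1 (norm_eq_zero.1 this)
  have h2 := congrArg norm h1
  simp only [norm_mul, norm_exp_ofReal_mul_I, norm_real, mul_one, Real.norm_eq_abs,
    abs_of_pos hr, abs_of_pos (hr.trans hR)] at h2
  linarith

lemma aux_poisson_int (r R θ : ℝ) (hr : 0 < r) (hR : r < R) :
    ∫⁻ α : ℝ in Ioc 0 (2 * Real.pi),
      ENNReal.ofReal (poissonKernel 0 (r * exp (α * I)) (R * exp (θ * I)))
      = ENNReal.ofReal (2 * Real.pi) := by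
  have hpi := Real.pi_pos
  have hw : (r * exp (θ * I) : ℂ) ∈ ball (0:ℂ) R := by
    simp [abs_of_pos hr, hR]
  have h := (diffContOnCl_const (𝕜 := ℂ) (s := ball (0:ℂ) R)
    (c := (1:ℂ))).circleAverage_poissonKernel_smul hw
  rw [Real.circleAverage_def] at h
  have h' : ((2 * Real.pi)⁻¹ : ℝ) * ∫ α in (0:ℝ)..(2 * Real.pi),
      poissonKernel 0 (r * exp (θ * I)) (R * exp (α * I)) = 1 := by
    simp only [Pi.smul_apply', circleMap, zero_add, real_smul, mul_one] at h
    rw [intervalIntegral.integral_ofReal, ← ofReal_mul] at h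
    exact ofReal_eq_one.1 h
  have hc : Continuous fun α : ℝ => poissonKernel 0 (r * exp (θ * I)) (R * exp (α * I)) := by
    have hm : Continuous fun α : ℝ => ((θ, α) : ℝ × ℝ) := by fun_prop
    have h2 := (aux_poisson_cont r R hr hR).comp hm
    simpa only [Function.comp_def] using h2
  have h4 : ∫ α in (0:ℝ)..(2 * Real.pi),
      poissonKernel 0 (r * exp (θ * I)) (R * exp (α * I)) = 2 * Real.pi := by
    have hne : (2 * Real.pi) ≠ 0 := by positivity
    rw [inv_mul_eq_div, div_eq_one_iff_eq hne] at h'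
    exact h'
  rw [intervalIntegral.integral_of_le (by positivity)] at h4
  have hi : Integrable (fun α : ℝ => poissonKernel 0 (r * exp (θ * I)) (R * exp (α * I)))
      (volume.restrict (Ioc 0 (2 * Real.pi))) :=
    (hc.integrableOn_Icc (a := 0) (b := 2 * Real.pi)).mono_set Ioc_subset_Icc_self
  have h5 := ofReal_integral_eq_lintegral_ofReal hi
    (Filter.Eventually.of_forall fun α => aux_poisson_nonneg r R θ α hr hR)
  rw [h4] at h5
  refine (lintegral_congr fun α => ?_).trans h5.symm
  rw [aux_poisson_symm r R α θ]

lemma aux_cont_circle (G : ℂ → ℂ) (hG : DifferentiableOn ℂ G (ball (0:ℂ) 1)) (R : ℝ)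
    (hR0 : 0 < R) (hR : R < 1) : Continuous fun θ : ℝ => G (R * exp (θ * I)) := by
  apply hG.continuousOn.comp_continuous (by fun_prop)
  intro θ
  simp [abs_of_pos hR0, hR]

lemma aux_mono (G : ℂ → ℂ) (hG : DifferentiableOn ℂ G (ball (0:ℂ) 1)) (r R : ℝ)
    (hr : 0 < r) (hrR : r < R) (hR : R < 1) :
    ∫⁻ α in Ioc 0 (2 * Real.pi), ‖G (r * exp (α * I))‖ₑ ≤
      ∫⁻ θ in Ioc 0 (2 * Real.pi), ‖G (R * exp (θ * I))‖ₑ := by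
  have hpi := Real.pi_pos
  have hcG := aux_cont_circle G hG R (hr.trans hrR) hR
  have hd : DiffContOnCl ℂ G (ball (0:ℂ) R) := by
    apply DifferentiableOn.diffContOnCl
    apply hG.mono
    exact closure_ball_subset_closedBall.trans (closedBall_subset_ball hR)
  have hp : ∀ α : ℝ, ‖G (r * exp (α * I))‖ₑ ≤ (ENNReal.ofReal (2 * Real.pi))⁻¹ *
      ∫⁻ θ in Ioc 0 (2 * Real.pi),
        ENNReal.ofReal (poissonKernel 0 (r * exp (α * I)) (R * exp (θ * I))) *
          ‖G (R * exp (θ * I))‖ₑ := by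
    intro α
    have hw : (r * exp (α * I) : ℂ) ∈ ball (0:ℂ) R := by
      simp [abs_of_pos hr, hrR]
    have h := hd.circleAverage_poissonKernel_smul hw
    rw [← h, Real.circleAverage_def, enorm_smul]
    rw [intervalIntegral.integral_of_le (by positivity)]
    have e1 : ‖((2 * Real.pi)⁻¹ : ℝ)‖ₑ = (ENNReal.ofReal (2 * Real.pi))⁻¹ := by
      rw [Real.enorm_eq_ofReal (by positivity), ENNReal.ofReal_inv_of_pos (by positivity)]
    rw [e1]
    gcongr
    refine (enorm_integral_le_lintegral_enorm _).trans (le_of_eq ?_)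
    refine lintegral_congr fun θ => ?_
    simp only [Pi.smul_apply', circleMap, zero_add]
    rw [enorm_smul, Real.enorm_eq_ofReal (aux_poisson_nonneg r R α θ hr hrR)]
  have hK := aux_poisson_cont r R hr hrR
  refine (lintegral_mono hp).trans ?_
  rw [lintegral_const_mul' _ _ (by simp [hpi]), lintegral_lintegral_swap]
  · have : ∀ θ : ℝ, ∫⁻ α in Ioc 0 (2 * Real.pi),
        ENNReal.ofReal (poissonKernel 0 (r * exp (α * I)) (R * exp (θ * I))) *
          ‖G (R * exp (θ * I))‖ₑ = ENNReal.ofReal (2 * Real.pi) * ‖G (R * exp (θ * I))‖ₑ := by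
      intro θ
      rw [lintegral_mul_const' _ _ enorm_ne_top, aux_poisson_int r R θ hr hrR]
    simp_rw [this]
    rw [lintegral_const_mul' _ _ ENNReal.ofReal_ne_top, ← mul_assoc, ENNReal.inv_mul_cancel,
      one_mul]
    · simp [hpi]
    · exact ENNReal.ofReal_ne_top
  · apply Measurable.aemeasurable
    exact Measurable.mul hK.measurable.ennreal_ofReal
      ((hcG.measurable.enorm).comp measurable_snd)
open Filter Topology

lemma aux_circle_ae (P : ℂ → Prop) (h : ∀ᵐ z ∂circleMeasure, P z) :
    ∀ᵐ θ : ℝ ∂(volume.restrict (Ioc 0 (2 * Real.pi)) : Measure ℝ), P (exp (θ * I)) := by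
  unfold circleMeasure at h
  have h1 := ae_of_ae_map (by fun_prop : Continuous fun θ : ℝ => exp (θ * I)).aemeasurable h
  rwa [Measure.ae_ennreal_smul_measure_eq (ENNReal.inv_ne_zero.2 ENNReal.ofReal_ne_top)] at h1

/-- The integral against `circleMeasure` in the angular parametrisation. -/
lemma aux_circle_lint (g : ℂ → ℝ≥0∞) (hg : AEMeasurable g circleMeasure) :
    ∫⁻ z, g z ∂circleMeasure = (ENNReal.ofReal (2 * Real.pi))⁻¹ *
      ∫⁻ θ in Ioc 0 (2 * Real.pi), g (exp (θ * I)) := by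
  unfold circleMeasure at hg ⊢
  rw [lintegral_map' hg (by fun_prop : Continuous fun θ : ℝ => exp (θ * I)).aemeasurable,
    lintegral_smul_measure, smul_eq_mul]

lemma aux_circle_norm : ∀ᵐ z ∂circleMeasure, ‖z‖ = 1 := by
  unfold circleMeasure
  rw [ae_map_iff (by fun_prop : Continuous fun θ : ℝ => exp (θ * I)).aemeasurable
    (measurableSet_eq_fun (by fun_prop) (by fun_prop))]
  exact Filter.Eventually.of_forall fun θ => norm_exp_ofReal_mul_I θ

lemma aux_aemeas_slice (G : ℂ → ℂ) (hG : DifferentiableOn ℂ G (ball (0:ℂ) 1)) (r : ℝ)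
    (hr : 0 < r) (hr1 : r < 1) : AEMeasurable (fun z => G (r * z)) circleMeasure := by
  have hs : MeasurableSet (sphere (0:ℂ) 1) := isClosed_sphere.measurableSet
  have hc : ContinuousOn (fun z => G (r * z)) (sphere (0:ℂ) 1) := by
    apply hG.continuousOn.comp (by fun_prop)
    intro z hz
    have : ‖z‖ = 1 := by simpa using hz
    simp [abs_of_pos hr, hr1, this]
  have h := hc.aemeasurable (μ := circleMeasure) hs
  rwa [Measure.restrict_eq_self_of_ae_mem] at h
  filter_upwards [aux_circle_norm] with z hz
  simpa using hz

open Filter Topology in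
lemma aux_limit (G gs : ℂ → ℂ) (hG : DifferentiableOn ℂ G (ball (0:ℂ) 1)) (M : ℝ)
    (hM : ∀ z ∈ ball (0:ℂ) 1, ‖G z‖ ≤ M) (hb : IsBoundaryFn G gs) (r : ℝ)
    (hr : 0 < r) (hr1 : r < 1) :
    ∫⁻ α in Ioc 0 (2 * Real.pi), ‖G (r * exp (α * I))‖ₑ ≤
      ∫⁻ θ in Ioc 0 (2 * Real.pi), ‖gs (exp (θ * I))‖ₑ := by
  have ht : Tendsto (fun R : ℝ => ∫⁻ θ in Ioc 0 (2 * Real.pi), ‖G (R * exp (θ * I))‖ₑ)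
      (𝓝[<] 1) (𝓝 (∫⁻ θ in Ioc 0 (2 * Real.pi), ‖gs (exp (θ * I))‖ₑ)) := by
    have hev : ∀ᶠ R : ℝ in 𝓝[<] 1, R ∈ Ioo (0:ℝ) 1 := Ioo_mem_nhdsLT one_pos
    apply tendsto_lintegral_filter_of_dominated_convergence (fun _ => ENNReal.ofReal M)
    · filter_upwards [hev] with R hR
      exact (aux_cont_circle G hG R hR.1 hR.2).measurable.enorm
    · filter_upwards [hev] with R hR
      refine Eventually.of_forall fun θ => ?_
      rw [← ofReal_norm]
      apply ENNReal.ofReal_le_ofReal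
      apply hM
      simp [abs_of_pos hR.1, hR.2]
    · simp [ENNReal.mul_eq_top]
    · filter_upwards [aux_circle_ae _ hb] with θ hθ
      exact hθ.enorm
  refine ge_of_tendsto ht ?_
  filter_upwards [Ioo_mem_nhdsLT hr1] with R hR
  exact aux_mono G hG r R hr hR.1 hR.2

lemma aux_norm_le (ζ η : ℂ) (hζ : ‖ζ‖ = 1) (hη : ‖η‖ = 1) (ε : ℝ) (hε : 0 < ε) :
    ‖η - ζ‖ ≤ ‖(1 + ε : ℝ) * ζ - η‖ := by
  have h1 : ζ.re * ζ.re + ζ.im * ζ.im = 1 := by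
    rw [← normSq_apply, normSq_eq_norm_sq, hζ]; norm_num
  have h2 : η.re * η.re + η.im * η.im = 1 := by
    rw [← normSq_apply, normSq_eq_norm_sq, hη]; norm_num
  rw [← sq_le_sq₀ (norm_nonneg _) (norm_nonneg _), ← normSq_eq_norm_sq, ← normSq_eq_norm_sq,
    normSq_apply, normSq_apply]
  simp only [sub_re, sub_im, mul_re, mul_im, ofReal_re, ofReal_im]
  nlinarith [mul_nonneg hε.le (sq_nonneg (ζ.re - η.re)), mul_nonneg hε.le (sq_nonneg (ζ.im - η.im)),
    sq_nonneg ε, mul_pos hε hε]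

/-- If `f ∈ H^∞` has boundary function `f*`, `ζ ∈ 𝕋`, `w ∈ ℂ` and
`C = ∫_𝕋 |f*(η) - w|/|η - ζ| dm(η) < ∞`, then `F(z) = (w - f(z))/(ζ - z)` is analytic on `𝔻`,
belongs to `H^1` and `‖F‖_{H^1} ≤ C`. -/
theorem quotient_in_H1 (f fs : ℂ → ℂ)
    (hf : DifferentiableOn ℂ f (Metric.ball (0 : ℂ) 1))
    (hfb : eSupAbs f ≠ ⊤)
    (hbf : IsBoundaryFn f fs)
    (ζ : ℂ) (hζ : ‖ζ‖ = 1) (w : ℂ)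
    (hC : ∫⁻ η, ENNReal.ofReal (‖fs η - w‖ / ‖η - ζ‖) ∂circleMeasure ≠ ⊤) :
    DifferentiableOn ℂ (fun z => (w - f z) / (ζ - z)) (Metric.ball (0 : ℂ) 1) ∧
      hardyNorm 1 (fun z => (w - f z) / (ζ - z)) ≤
        ∫⁻ η, ENNReal.ofReal (‖fs η - w‖ / ‖η - ζ‖) ∂circleMeasure := by
  have hpi := Real.pi_pos
  have hne : ∀ z ∈ ball (0:ℂ) 1, ζ - z ≠ 0 := by
    intro z hz h
    have : ‖z‖ < 1 := by simpa using hz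
    rw [← sub_eq_zero.1 h, hζ] at this
    exact lt_irrefl _ this
  have hFd : DifferentiableOn ℂ (fun z => (w - f z) / (ζ - z)) (Metric.ball (0 : ℂ) 1) :=
    ((differentiableOn_const w).sub hf).div ((differentiableOn_const ζ).sub differentiableOn_id) hne
  refine ⟨hFd, ?_⟩
  -- a bound for `f`
  obtain ⟨M, hM⟩ : ∃ M : ℝ, ∀ z ∈ ball (0:ℂ) 1, ‖f z‖ ≤ M := by
    refine ⟨(eSupAbs f).toReal, fun z hz => ?_⟩
    rw [← ENNReal.ofReal_le_iff_le_toReal hfb]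
    exact le_iSup₂ (f := fun z (_ : z ∈ Metric.ball (0 : ℂ) 1) => ENNReal.ofReal ‖f z‖) z hz
  have hfsm : AEMeasurable fs circleMeasure := by
    have hlim : Tendsto (fun n : ℕ => (1 - 1 / ((n:ℝ) + 2))) atTop (𝓝[<] 1) := by
      rw [tendsto_nhdsWithin_iff]
      constructor
      · have h0 : Tendsto (fun n : ℕ => 1 / ((n:ℝ) + 2)) atTop (𝓝 0) := by
          simp_rw [one_div]
          exact tendsto_inv_atTop_zero.comp
            (tendsto_atTop_add_const_right _ _ tendsto_natCast_atTop_atTop)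
        simpa using h0.const_sub 1
      · refine Eventually.of_forall fun n => ?_
        have : 0 < 1 / ((n:ℝ) + 2) := by positivity
        simp only [mem_Iio]
        linarith
    refine aemeasurable_of_tendsto_metrizable_ae atTop
      (f := fun (n : ℕ) z => f (((1 - 1 / ((n:ℝ) + 2) : ℝ) : ℂ) * z)) (fun n => ?_) ?_
    · apply aux_aemeas_slice f hf
      · have : 1 / ((n:ℝ) + 2) < 1 := by
          rw [div_lt_one (by positivity)]
          have : (0:ℝ) ≤ n := n.cast_nonneg
          linarith
        linarith
      · have : 0 < 1 / ((n:ℝ) + 2) := by positivity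
        linarith
    · filter_upwards [hbf] with z hz
      exact hz.comp hlim
  rw [aux_circle_lint (fun η => ENNReal.ofReal (‖fs η - w‖ / ‖η - ζ‖))
    (((hfsm.sub_const w).norm.div (aemeasurable_id.sub_const ζ).norm).ennreal_ofReal)]
  unfold hardyNorm
  refine iSup₂_le fun r hr => ?_
  simp only [Real.rpow_one]
  have hcr : AEMeasurable (fun z => ENNReal.ofReal ‖(w - f (r * z)) / (ζ - r * z)‖)
      circleMeasure :=
    (aux_aemeas_slice (fun z => (w - f z) / (ζ - z)) hFd r hr.1 hr.2).norm.ennreal_ofReal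
  rw [aux_circle_lint _ hcr]
  gcongr (ENNReal.ofReal (2 * Real.pi))⁻¹ * ?_
  simp_rw [ofReal_norm]
  -- the regularised functions
  have step : ∀ ε : ℝ, 0 < ε → ∫⁻ θ in Ioc 0 (2 * Real.pi),
      ‖(w - f (r * exp (θ * I))) / ((1 + ε : ℝ) * ζ - r * exp (θ * I))‖ₑ ≤
      ∫⁻ θ in Ioc 0 (2 * Real.pi),
        ENNReal.ofReal (‖fs (exp (θ * I)) - w‖ / ‖exp (θ * I) - ζ‖) := by
    intro ε hε
    have hden : ∀ z : ℂ, ‖z‖ ≤ 1 → ε ≤ ‖(1 + ε : ℝ) * ζ - z‖ := by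
      intro z hz
      have h := norm_sub_norm_le ((1 + ε : ℝ) * ζ) z
      rw [norm_mul, hζ, norm_real, Real.norm_eq_abs, abs_of_pos (by positivity)] at h
      linarith
    have hden0 : ∀ z : ℂ, ‖z‖ ≤ 1 → (1 + ε : ℝ) * ζ - z ≠ 0 := by
      intro z hz
      exact norm_pos_iff.1 (hε.trans_le (hden z hz))
    have hball : ∀ z ∈ ball (0:ℂ) 1, ‖z‖ ≤ 1 := by
      intro z hz
      have : ‖z‖ < 1 := by simpa using hz
      exact this.le
    have hd : DifferentiableOn ℂ (fun z => (w - f z) / ((1 + ε : ℝ) * ζ - z)) (ball (0 : ℂ) 1) :=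
      ((differentiableOn_const w).sub hf).div
        ((differentiableOn_const _).sub differentiableOn_id) (fun z hz => hden0 z (hball z hz))
    refine (aux_limit _ (fun z => (w - fs z) / ((1 + ε : ℝ) * ζ - z)) hd ((‖w‖ + M) / ε)
      ?_ ?_ r hr.1 hr.2).trans ?_
    · intro z hz
      rw [norm_div]
      have h1 : ‖w - f z‖ ≤ ‖w‖ + M := (norm_sub_le _ _).trans (by linarith [hM z hz])
      exact div_le_div₀ ((norm_nonneg _).trans h1) h1 hε (hden z (hball z hz))
    · unfold IsBoundaryFn at hbf ⊢
      filter_upwards [hbf, aux_circle_norm] with z hz hz1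
      refine Tendsto.div (hz.const_sub w) ?_ (hden0 z hz1.le)
      have : Tendsto (fun R : ℝ => (1 + ε : ℝ) * ζ - (R:ℂ) * z) (𝓝 1)
          (𝓝 ((1 + ε : ℝ) * ζ - ((1:ℝ):ℂ) * z)) := by
        apply Continuous.tendsto
        fun_prop
      rw [ofReal_one, one_mul] at this
      exact this.mono_left nhdsWithin_le_nhds
    · -- the point `ζ` itself has to be removed
      have hae : ∀ᵐ θ : ℝ ∂(volume.restrict (Ioc 0 (2 * Real.pi)) : Measure ℝ),
          exp (θ * I) - ζ ≠ 0 := by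
        have hcount : {θ : ℝ | exp (θ * I) = ζ}.Countable := by
          refine (countable_range fun n : ℤ => ζ.arg + n * (2 * Real.pi)).mono ?_
          intro θ hθ
          have h1 : exp (θ * I) = exp (ζ.arg * I) := by
            have h2 := norm_mul_exp_arg_mul_I ζ
            rw [hζ, ofReal_one, one_mul] at h2
            rw [h2]
            exact hθ
          obtain ⟨n, hn⟩ := exp_eq_exp_iff_exists_int.1 h1
          refine ⟨n, ?_⟩
          have h3 := congrArg Complex.im hn
          simp at h3
          simp [h3]
        have h0 := ae_restrict_of_ae (s := Ioc 0 (2 * Real.pi))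
          (measure_eq_zero_iff_ae_notMem.1 (hcount.measure_zero (volume : Measure ℝ)))
        filter_upwards [h0] with θ hθ h
        exact hθ (sub_eq_zero.1 h)
      apply lintegral_mono_ae
      filter_upwards [hae] with θ hθ
      rw [← ofReal_norm, norm_div, norm_sub_rev w]
      apply ENNReal.ofReal_le_ofReal
      exact div_le_div_of_nonneg_left (norm_nonneg _) (norm_pos_iff.2 hθ)
        (aux_norm_le ζ _ hζ (norm_exp_ofReal_mul_I θ) ε hε)
  -- dominated convergence on the circle of radius r is replaced by Fatou
  have hpt : ∀ θ : ℝ, ‖(w - f (r * exp (θ * I))) / (ζ - r * exp (θ * I))‖ₑ =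
      liminf (fun n : ℕ => ‖(w - f (r * exp (θ * I))) /
        ((1 + 1 / ((n:ℝ) + 1) : ℝ) * ζ - r * exp (θ * I))‖ₑ) atTop := by
    intro θ
    refine (Tendsto.liminf_eq ?_).symm
    refine Tendsto.enorm ?_
    have hz : (r * exp (θ * I) : ℂ) ∈ ball (0:ℂ) 1 := by
      simp [abs_of_pos hr.1, hr.2]
    refine Tendsto.div tendsto_const_nhds ?_ (hne _ hz)
    have h1 : Tendsto (fun n : ℕ => (1 + 1 / ((n:ℝ) + 1) : ℝ)) atTop (𝓝 1) := by
      simpa using (tendsto_one_div_add_atTop_nhds_zero_nat (𝕜 := ℝ)).const_add 1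
    have h2 : Tendsto (fun n : ℕ => (((1 + 1 / ((n:ℝ) + 1) : ℝ)) : ℂ)) atTop (𝓝 ((1:ℝ):ℂ)) :=
      (continuous_ofReal.tendsto 1).comp h1
    simpa using (h2.mul_const ζ).sub_const (r * exp (θ * I))
  simp_rw [hpt]
  refine (lintegral_liminf_le' fun n => ?_).trans ?_
  · apply Measurable.aemeasurable
    apply Measurable.enorm
    have := (aux_cont_circle f hf r hr.1 hr.2).measurable
    exact (measurable_const.sub this).div (by fun_prop)
  · refine (liminf_le_liminf (v := fun _ => ∫⁻ θ in Ioc 0 (2 * Real.pi),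
        ENNReal.ofReal (‖fs (exp (θ * I)) - w‖ / ‖exp (θ * I) - ζ‖)) ?_).trans ?_
    · exact Eventually.of_forall fun n => step _ (by positivity)
    · simp
end

section
/- (Lemma 1.) If p_n is a complex polynomial of degree at most n, then ‖p_n‖_𝔑 ≤ 3 ‖p_n‖_{H^∞} log(n + 2); that is, sup_{z∈𝔻}|p_n(z)| + sup_{η∈𝕋} ∫_𝕋 |p_n(ζ) − p_n(η)|/|ζ − η| dm(ζ) ≤ 3 · sup_{z∈𝔻}|p_n(z)| · log(n + 2). -/
open MeasureTheory Complex Metric Set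
open scoped ENNReal

lemma aux_iter (P : Polynomial ℂ) (k : ℕ) :
    iteratedDeriv k (fun z => P.eval z) = fun z => ((Polynomial.derivative)^[k] P).eval z := by
  induction k with
  | zero => simp
  | succ k ih =>
    rw [iteratedDeriv_succ, ih, Function.iterate_succ_apply']
    funext z
    exact Polynomial.deriv _

lemma aux_coeff (P : Polynomial ℂ) (M : ℝ) (hM : ∀ z ∈ sphere (0:ℂ) 1, ‖P.eval z‖ ≤ M) (k : ℕ) :
    ‖P.coeff k‖ ≤ M := by
  have h := norm_iteratedDeriv_le_of_forall_mem_sphere_norm_le (c := 0) (R := 1) (C := M)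
    (f := fun z => P.eval z) k one_pos P.differentiable.diffContOnCl hM
  rw [aux_iter] at h
  simp only [← Polynomial.coeff_zero_eq_eval_zero, Polynomial.coeff_iterate_derivative] at h
  simp only [zero_add, Nat.descFactorial_self, nsmul_eq_mul, norm_mul, one_pow, div_one,
    Complex.norm_natCast] at h
  exact le_of_mul_le_mul_left h (by exact_mod_cast Nat.factorial_pos k)

lemma aux_pow (z w : ℂ) (hz : ‖z‖ = 1) (hw : ‖w‖ = 1) (k : ℕ) :
    ‖z ^ k - w ^ k‖ ≤ k * ‖z - w‖ := by
  rw [← geom_sum₂_mul, norm_mul]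
  gcongr
  refine (norm_sum_le _ _).trans ?_
  simp [hz, hw]

lemma aux_lip (n : ℕ) (P : Polynomial ℂ) (hdeg : P.degree ≤ n) (M : ℝ)
    (hM : ∀ z ∈ sphere (0:ℂ) 1, ‖P.eval z‖ ≤ M) (z w : ℂ) (hz : ‖z‖ = 1) (hw : ‖w‖ = 1) :
    ‖P.eval z - P.eval w‖ ≤ M * (n * (n + 1) / 2) * ‖z - w‖ := by
  have hn : P.natDegree < n + 1 := Nat.lt_succ_of_le (Polynomial.natDegree_le_of_degree_le hdeg)
  have hM0 : 0 ≤ M := (norm_nonneg _).trans (aux_coeff P M hM 0)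
  rw [Polynomial.eval_eq_sum_range' hn, Polynomial.eval_eq_sum_range' hn, ← Finset.sum_sub_distrib]
  refine (norm_sum_le _ _).trans ?_
  calc _ ≤ ∑ i ∈ Finset.range (n+1), M * (i * ‖z - w‖) := by
        refine Finset.sum_le_sum fun i _ => ?_
        rw [← mul_sub, norm_mul]
        exact mul_le_mul (aux_coeff P M hM i) (aux_pow z w hz hw i) (norm_nonneg _) hM0
    _ = _ := by
        rw [← Finset.mul_sum, ← Finset.sum_mul]
        have : ∑ i ∈ Finset.range (n+1), (i:ℝ) = n * (n+1) / 2 := by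
          induction n with
          | zero => simp
          | succ m ih => 
            clear hdeg hn
            have : ∀ m : ℕ, ∑ i ∈ Finset.range (m+1), (i:ℝ) = m * (m+1) / 2 := by
              intro m
              induction m with
              | zero => simp
              | succ m ih => rw [Finset.sum_range_succ, ih]; push_cast; ring
            exact this _
        rw [this]; ring

/-- comparison kernel -/
noncomputable def auxG (K t : ℝ) : ℝ := min K (2 / ‖Complex.exp (I * t) - 1‖)

lemma auxG_per (K : ℝ) : Function.Periodic (auxG K) (2 * Real.pi) := by
  intro t
  unfold auxG
  have : I * ((t + 2 * Real.pi : ℝ) : ℂ) = I * t + 2 * Real.pi * I := by push_cast; ring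
  rw [this, Complex.exp_periodic]

lemma auxG_meas (K : ℝ) : Measurable (auxG K) := by
  unfold auxG; fun_prop

lemma auxG_nonneg (K t : ℝ) (hK : 0 ≤ K) : 0 ≤ auxG K t := le_min hK (by positivity)

lemma auxG_int (K a b : ℝ) (hK : 0 ≤ K) : IntervalIntegrable (auxG K) volume a b := by
  refine (intervalIntegrable_const (c := K)).mono_fun (auxG_meas K).aestronglyMeasurable ?_
  refine Filter.Eventually.of_forall fun t => ?_
  show ‖auxG K t‖ ≤ ‖K‖
  rw [Real.norm_of_nonneg (auxG_nonneg K t hK), Real.norm_of_nonneg hK]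
  exact min_le_left _ _

lemma auxG_le (K t : ℝ) (h0 : 0 < t) (h1 : t ≤ Real.pi) : auxG K t ≤ Real.pi * t⁻¹ := by
  refine (min_le_right _ _).trans ?_
  rw [norm_exp_I_mul_ofReal_sub_one]
  have h := Real.mul_le_sin (x := t / 2) (by linarith) (by linarith)
  have hpi := Real.pi_pos
  have h2 : 0 < 2 / Real.pi * (t/2) := by positivity
  rw [Real.norm_of_nonneg (by linarith), ← div_eq_mul_inv, div_le_div_iff₀ (by linarith) h0]
  have h3 : Real.pi * (2 / Real.pi * (t/2)) = t := by field_simp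
  nlinarith

lemma auxG_half (K : ℝ) (hK : 1 ≤ K) :
    ∫ t in (0:ℝ)..Real.pi, auxG K t ≤ Real.pi * (1 + Real.log K) := by
  have hpi := Real.pi_pos
  have hK0 : 0 < K := by linarith
  have hd : 0 < Real.pi / K := by positivity
  have hd1 : Real.pi / K ≤ Real.pi := div_le_self hpi.le hK
  rw [← intervalIntegral.integral_add_adjacent_intervals (auxG_int K 0 (Real.pi / K) hK0.le)
    (auxG_int K (Real.pi / K) Real.pi hK0.le)]
  have A : ∫ t in (0:ℝ)..(Real.pi / K), auxG K t ≤ ∫ t in (0:ℝ)..(Real.pi / K), K :=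
    intervalIntegral.integral_mono_on hd.le (auxG_int K _ _ hK0.le) intervalIntegrable_const
      fun t _ => min_le_left _ _
  have B : ∫ t in (Real.pi / K)..Real.pi, auxG K t
      ≤ ∫ t in (Real.pi / K)..Real.pi, Real.pi * t⁻¹ := by
    refine intervalIntegral.integral_mono_on hd1 (auxG_int K _ _ hK0.le) ?_
      fun t ht => auxG_le K t (hd.trans_le ht.1) ht.2
    refine (ContinuousOn.intervalIntegrable ?_)
    refine continuousOn_const.mul (continuousOn_inv₀.mono ?_)
    intro t ht
    rw [uIcc_of_le hd1] at ht
    exact (hd.trans_le ht.1).ne'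
  rw [intervalIntegral.integral_const_mul, integral_inv_of_pos hd hpi] at B
  rw [intervalIntegral.integral_const, smul_eq_mul] at A
  have e1 : (Real.pi / K - 0) * K = Real.pi := by field_simp; ring
  have e2 : Real.pi / (Real.pi / K) = K := by field_simp
  rw [e1] at A
  rw [e2] at B
  linarith

lemma auxG_even (K t : ℝ) : auxG K (-t) = auxG K t := by
  unfold auxG
  rw [norm_exp_I_mul_ofReal_sub_one, norm_exp_I_mul_ofReal_sub_one, neg_div, Real.sin_neg]
  simp

lemma auxG_full (K a : ℝ) (hK : 1 ≤ K) :
    ∫ t in (0:ℝ)..(2 * Real.pi), auxG K (t - a) ≤ 2 * Real.pi * (1 + Real.log K) := by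
  rw [intervalIntegral.integral_comp_sub_right (auxG K) a]
  have h := (auxG_per K).intervalIntegral_add_eq (0 - a) (-Real.pi)
  rw [show 2 * Real.pi - a = 0 - a + 2 * Real.pi by ring, h,
    show -Real.pi + 2 * Real.pi = Real.pi by ring,
    ← intervalIntegral.integral_add_adjacent_intervals (auxG_int K _ 0 (by linarith))
    (auxG_int K 0 _ (by linarith))]
  have h2 : ∫ t in (-Real.pi)..0, auxG K t = ∫ t in (0:ℝ)..Real.pi, auxG K t := by
    have := intervalIntegral.integral_comp_neg (a := 0) (b := Real.pi) (auxG K)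
    simp only [auxG_even, neg_zero] at this
    exact this.symm
  have := auxG_half K hK
  rw [h2]
  linarith

lemma aux_log (n : ℕ) :
    1 + (1 + Real.log ((n:ℝ) * (n + 1) / 2 + 1)) ≤ 3 * Real.log ((n:ℝ) + 2) := by
  have hn : (0:ℝ) ≤ n := n.cast_nonneg
  have hK : (0:ℝ) < (n:ℝ) * (n + 1) / 2 + 1 := by positivity
  have e2 : Real.exp 2 ≤ 7.4 := by
    have h := Real.exp_one_lt_d9
    have : Real.exp 2 = Real.exp 1 * Real.exp 1 := by rw [← Real.exp_add]; norm_num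
    rw [this]
    have := Real.exp_pos 1
    nlinarith
  have h2 : (2:ℝ) = Real.log (Real.exp 2) := (Real.log_exp 2).symm
  have h3 : 3 * Real.log ((n:ℝ) + 2) = Real.log (((n:ℝ) + 2) ^ 3) := by
    rw [Real.log_pow]; norm_num
  have : Real.log (Real.exp 2 * ((n:ℝ) * (n + 1) / 2 + 1)) ≤ Real.log (((n:ℝ) + 2) ^ 3) := by
    apply Real.log_le_log (by positivity)
    calc _ ≤ 7.4 * ((n:ℝ) * (n + 1) / 2 + 1) := by gcongr
      _ ≤ _ := by nlinarith [pow_nonneg hn 3, pow_nonneg hn 2]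
  rw [Real.log_mul (Real.exp_pos 2).ne' hK.ne', Real.log_exp] at this
  linarith

lemma aux_lam (n : ℕ) (P : Polynomial ℂ) (hdeg : P.degree ≤ n) (M : ℝ)
    (hM : ∀ z ∈ sphere (0:ℂ) 1, ‖P.eval z‖ ≤ M) (η : ℂ) (hη : η ∈ sphere (0:ℂ) 1) :
    ∫⁻ ζ, ENNReal.ofReal (‖P.eval ζ - P.eval η‖ / ‖ζ - η‖) ∂circleMeasure ≤
      ENNReal.ofReal (M * (1 + Real.log ((n:ℝ) * (n + 1) / 2 + 1))) := by
  have hM0 : 0 ≤ M := (norm_nonneg _).trans (hM η hη)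
  have hη1 : ‖η‖ = 1 := by simpa using hη
  have hpi := Real.pi_pos
  set K : ℝ := (n:ℝ) * (n + 1) / 2 + 1 with hKdef
  have hK : 1 ≤ K := by rw [hKdef]; have : (0:ℝ) ≤ (n:ℝ) * (n + 1) / 2 := by positivity
                        linarith
  set a := Complex.arg η with ha
  have hηa : η = Complex.exp (a * I) := by
    have := Complex.norm_mul_exp_arg_mul_I η
    rw [hη1] at this; simpa using this.symm
  have hmP : Measurable fun z : ℂ => P.eval z := P.continuous.measurable
  unfold circleMeasure
  rw [lintegral_map (by fun_prop) (by fun_prop), lintegral_smul_measure]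
  have key : ∀ t : ℝ, ‖P.eval (Complex.exp (t * I)) - P.eval η‖ / ‖Complex.exp (t * I) - η‖
      ≤ M * auxG K (t - a) := by
    intro t
    have hz : ‖Complex.exp (t * I)‖ = 1 := Complex.norm_exp_ofReal_mul_I t
    have hn : ‖Complex.exp (t * I) - η‖ = ‖Complex.exp (I * ((t - a : ℝ) : ℂ)) - 1‖ := by
      have : Complex.exp (t * I) - η = η * (Complex.exp (I * ((t - a : ℝ) : ℂ)) - 1) := by
        rw [hηa, mul_sub, ← Complex.exp_add]
        congr 2
        · push_cast; ring
        · ring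
      rw [this, norm_mul, hη1, one_mul]
    have h1 := aux_lip n P hdeg M hM _ η hz hη1
    have h2 : ‖P.eval (Complex.exp (t * I)) - P.eval η‖ ≤ M * 2 := by
      refine (norm_sub_le _ _).trans ?_
      have := hM _ (show Complex.exp (t * I) ∈ sphere (0:ℂ) 1 by simp [hz])
      have := hM _ hη
      linarith
    unfold auxG
    rw [← hn, mul_min_of_nonneg _ _ hM0]
    refine le_min ?_ ?_
    · refine div_le_of_le_mul₀ (norm_nonneg _) (by positivity) (h1.trans ?_)
      gcongr
      rw [hKdef]; linarith
    · rw [← mul_div_assoc]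
      gcongr
  have hint := auxG_int K (0 - a) (2 * Real.pi - a) (by linarith)
  have hint2 : IntervalIntegrable (fun t => M * auxG K (t - a)) volume 0 (2 * Real.pi) := by
    have := (hint.comp_sub_right a).const_mul M
    simpa using this
  calc _ ≤ (ENNReal.ofReal (2 * Real.pi))⁻¹ •
        ∫⁻ t in Ioc 0 (2 * Real.pi), ENNReal.ofReal (M * auxG K (t - a)) := by
        gcongr with t
        exact key t
    _ = (ENNReal.ofReal (2 * Real.pi))⁻¹ •
        ENNReal.ofReal (∫ t in (0:ℝ)..(2 * Real.pi), M * auxG K (t - a)) := by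
        rw [intervalIntegral.integral_of_le (by positivity), ofReal_integral_eq_lintegral_ofReal]
        · rw [intervalIntegrable_iff_integrableOn_Ioc_of_le (by positivity)] at hint2
          exact hint2
        · exact Filter.Eventually.of_forall fun t =>
            mul_nonneg hM0 (auxG_nonneg K _ (by linarith))
    _ ≤ (ENNReal.ofReal (2 * Real.pi))⁻¹ •
        ENNReal.ofReal (2 * Real.pi * (M * (1 + Real.log K))) := by
        gcongr
        rw [intervalIntegral.integral_const_mul]
        have := mul_le_mul_of_nonneg_left (auxG_full K a hK) hM0
        linarith
    _ = _ := by
        have h2pi : (0:ℝ) ≤ 2 * Real.pi := by positivity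
        rw [ENNReal.ofReal_mul (p := 2 * Real.pi) (q := M * (1 + Real.log K)) h2pi, smul_eq_mul,
          ← mul_assoc (ENNReal.ofReal (2 * Real.pi))⁻¹, ENNReal.inv_mul_cancel (by simp [hpi]) ENNReal.ofReal_ne_top, one_mul]

/-- **Lemma 1.** If `p_n` is a complex polynomial of degree at most `n`, then
`‖p_n‖_𝔑 = ‖p_n‖_{H^∞} + sup_{η∈𝕋} ∫_𝕋 |p_n(ζ) - p_n(η)|/|ζ - η| dm(ζ)
  ≤ 3 ‖p_n‖_{H^∞} log(n + 2)`. -/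
theorem polynomial_frakN_bound (n : ℕ) (P : Polynomial ℂ) (hdeg : P.degree ≤ n) :
    (⨆ z ∈ Metric.ball (0 : ℂ) 1, ENNReal.ofReal (‖P.eval z‖)) +
      (⨆ η ∈ Metric.sphere (0 : ℂ) 1,
        ∫⁻ ζ, ENNReal.ofReal (‖P.eval ζ - P.eval η‖ / ‖ζ - η‖)
          ∂circleMeasure) ≤
      3 * (⨆ z ∈ Metric.ball (0 : ℂ) 1, ENNReal.ofReal (‖P.eval z‖)) *
        ENNReal.ofReal (Real.log ((n : ℝ) + 2)) := by
  set S := ⨆ z ∈ Metric.ball (0 : ℂ) 1, ENNReal.ofReal (‖P.eval z‖) with hS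
  have hfin : S ≠ ⊤ := by
    obtain ⟨C, hC⟩ := (isCompact_closedBall (0:ℂ) 1).exists_bound_of_continuousOn
      (f := fun z => P.eval z) P.continuous.continuousOn
    refine ne_top_of_le_ne_top (ENNReal.ofReal_ne_top (r := C)) ?_
    exact iSup₂_le fun z hz => ENNReal.ofReal_le_ofReal (hC z (ball_subset_closedBall hz))
  have hball : ∀ z ∈ ball (0:ℂ) 1, ‖P.eval z‖ ≤ S.toReal := by
    intro z hz
    rw [← ENNReal.ofReal_le_iff_le_toReal hfin]
    exact le_iSup₂ (f := fun z (_ : z ∈ ball (0:ℂ) 1) => ENNReal.ofReal (‖P.eval z‖)) z hz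
  have hM : ∀ z ∈ sphere (0:ℂ) 1, ‖P.eval z‖ ≤ S.toReal := by
    intro z hz
    have hcl : z ∈ closure (ball (0:ℂ) 1) := by
      rw [closure_ball _ one_ne_zero]; exact sphere_subset_closedBall hz
    have hclosed : IsClosed {z : ℂ | ‖P.eval z‖ ≤ S.toReal} :=
      isClosed_le P.continuous.norm continuous_const
    exact closure_minimal (fun z hz => hball z hz) hclosed hcl
  have hM0 : 0 ≤ S.toReal := ENNReal.toReal_nonneg
  have hlog := aux_log n
  have hlogK : 0 ≤ Real.log ((n:ℝ) * (n + 1) / 2 + 1) :=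
    Real.log_nonneg (by have : (0:ℝ) ≤ (n:ℝ) * (n + 1) / 2 := by positivity
                        linarith)
  have hL : (⨆ η ∈ Metric.sphere (0 : ℂ) 1,
        ∫⁻ ζ, ENNReal.ofReal (‖P.eval ζ - P.eval η‖ / ‖ζ - η‖) ∂circleMeasure) ≤
      ENNReal.ofReal (S.toReal * (1 + Real.log ((n:ℝ) * (n + 1) / 2 + 1))) :=
    iSup₂_le fun η hη => aux_lam n P hdeg S.toReal hM η hη
  refine (add_le_add le_rfl hL).trans ?_
  rw [← ENNReal.ofReal_toReal hfin, ENNReal.toReal_ofReal hM0,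
    ← ENNReal.ofReal_add hM0 (by positivity), show (3 : ℝ≥0∞) = ENNReal.ofReal 3 by simp,
    ← ENNReal.ofReal_mul (by norm_num), ← ENNReal.ofReal_mul (by positivity)]
  apply ENNReal.ofReal_le_ofReal
  have := mul_le_mul_of_nonneg_left hlog hM0
  linarith
end
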